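/- arXiv:1912.12323 — 2 statements merged into one kernel-verified Lean document; each statement's English description precedes it below -/
import Mathlib

section
/- (Pink.) Let θ > 1 be a fundamental unit of the real quadratic field K = ℚ(θ) with O_K = ℤ[θ]. Then j^qt(θ) = { j(𝔞_x) : x ∈ [0,1) } ∪ { j(𝔞_x⁺) : x ∈ [0,1) }: the set of accumulation points of j_ε(θ) as ε → 0⁺ coincides exactly with the set of quasicrystalline modular invariants of the quasicrystals 𝔞_x and 𝔞_x⁺ for x ∈ [0,1). -/
open NumberField Filter
open scoped Topology

noncomputable section

/-- The zeta function of a subset `S ⊆ ℝ`: `ζ_S(s) = Σ_{t ∈ S, t > 0} t^{-s}`. -/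
def zSet (S : Set ℝ) (s : ℝ) : ℝ :=
  ∑' t : {t : ℝ // t ∈ S ∧ 0 < t}, (t : ℝ) ^ (-s)

open Classical in
/-- The quasicrystalline modular invariant
`j(𝔞) = 12³/(1 - (49/40)·ζ_𝔞(6)²/ζ_𝔞(4)³) ∈ ℝ ∪ {∞}`. -/
def jaySet (S : Set ℝ) : OnePoint ℝ :=
  if (1 - (49 / 40) * (zSet S 6) ^ 2 / (zSet S 4) ^ 3) = 0 then OnePoint.infty
  else (((12 ^ 3 : ℝ) / (1 - (49 / 40) * (zSet S 6) ^ 2 / (zSet S 4) ^ 3) : ℝ) : OnePoint ℝ)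

/-- The distance from a real number to the nearest integer. -/
def distNearestInt (x : ℝ) : ℝ := |x - round x|

/-- The set of diophantine approximations `Λ_ε(θ) = {n ∈ ℤ : ‖nθ‖ < ε}`. -/
def LambdaEps (θ ε : ℝ) : Set ℤ := {n : ℤ | distNearestInt (n * θ) < ε}

/-- `ζ_{θ,ε}(s) = Σ_{0<n∈Λ_ε(θ)} n^{-s}`. -/
def zetaEps (θ ε s : ℝ) : ℝ :=
  ∑' n : {n : ℤ // n ∈ LambdaEps θ ε ∧ 0 < n}, ((n : ℤ) : ℝ) ^ (-s)

open Classical in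
/-- The approximants `j_ε(θ) = 12³/(1 - (49/40)·ζ_{θ,ε}(6)²/ζ_{θ,ε}(4)³)`. -/
def jEps (θ ε : ℝ) : OnePoint ℝ :=
  if (1 - (49 / 40) * (zetaEps θ ε 6) ^ 2 / (zetaEps θ ε 4) ^ 3) = 0 then OnePoint.infty
  else (((12 ^ 3 : ℝ) /
    (1 - (49 / 40) * (zetaEps θ ε 6) ^ 2 / (zetaEps θ ε 4) ^ 3) : ℝ) : OnePoint ℝ)

/-- The quantum modular invariant `j^qt(θ)`: the set of accumulation points of `j_ε(θ)` as
`ε → 0⁺`, in the one-point compactification of `ℝ`. -/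
def jqt (θ : ℝ) : Set (OnePoint ℝ) :=
  {y : OnePoint ℝ | MapClusterPt y (𝓝[>] (0 : ℝ)) (fun ε => jEps θ ε)}

/-- The quasicrystals `𝔞_x = {α ∈ O_K : |α′| < θ^{-x}}` of a real quadratic field `K = ℚ(θ)`
embedded in `ℝ` by `ι`, with Galois conjugation `g`. -/
def aQC (K : Type*) [Field K] [NumberField K] (ι : K →+* ℝ) (g : K ≃+* K) (θ : ℝ) (x : ℝ) :
    Set ℝ :=
  {t : ℝ | ∃ α : 𝓞 K, ι (α : K) = t ∧ |ι (g (α : K))| < θ ^ (-x)}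

/-- The quasicrystals `𝔞_x⁺ = {α ∈ O_K : |α′| ≤ θ^{-x}}`. -/
def aQCplus (K : Type*) [Field K] [NumberField K] (ι : K →+* ℝ) (g : K ≃+* K) (θ : ℝ)
    (x : ℝ) : Set ℝ :=
  {t : ℝ | ∃ α : 𝓞 K, ι (α : K) = t ∧ |ι (g (α : K))| ≤ θ ^ (-x)}

/-- Real data of a quadratic unit `θ > 1` with conjugate `η`, trace `a` and norm `σ`. -/
structure IsQuadUnit (θ η : ℝ) (a σ : ℤ) : Prop where
  one_lt : 1 < θ
  add_conj : θ + η = a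
  mul_conj : θ * η = σ
  sq_norm : σ ^ 2 = 1
  irrational : ∀ m n : ℤ, (m : ℝ) = n * θ → n = 0

/-- The linear form `(m, n) ↦ m - n θ`. -/
def linForm (θ : ℝ) (p : ℤ × ℤ) : ℝ := p.1 - p.2 * θ

/-- The coordinates of the elements `α = m - n η` with `α > 0` and `|α'| < r`. -/
def strip (θ η r : ℝ) : Set (ℤ × ℤ) := {p | |linForm θ p| < r ∧ 0 < linForm η p}

/-- The coordinates of the elements `α = m - n η` with `α > 0` and `|α'| ≤ r`. -/
def closedStrip (θ η r : ℝ) : Set (ℤ × ℤ) := {p | |linForm θ p| ≤ r ∧ 0 < linForm η p}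

/-- The sum of `α ^ (-s)` over the `α = m - n η` with coordinates in `S`. -/
def zetaOn (η : ℝ) (S : Set (ℤ × ℤ)) (s : ℝ) : ℝ :=
  ∑' p, S.indicator (fun p => linForm η p ^ (-s)) p

/-- The ratio `ζ(6)² / ζ(4)³` of the zeta function over `S`. -/
def ratioOn (η : ℝ) (S : Set (ℤ × ℤ)) : ℝ := zetaOn η S 6 ^ 2 / zetaOn η S 4 ^ 3

open Classical in
/-- The modular invariant as a function of the ratio `t = ζ(6)² / ζ(4)³`. -/
def jayOf (t : ℝ) : OnePoint ℝ :=
  if 1 - 49 / 40 * t = 0 then OnePoint.infty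
  else (((12 ^ 3 : ℝ) / (1 - 49 / 40 * t) : ℝ) : OnePoint ℝ)

theorem jaySet_eq (S : Set ℝ) : jaySet S = jayOf (zSet S 6 ^ 2 / zSet S 4 ^ 3) := by
  simp only [jaySet, jayOf, mul_div_assoc]

theorem jEps_eq (θ ε : ℝ) : jEps θ ε = jayOf (zetaEps θ ε 6 ^ 2 / zetaEps θ ε 4 ^ 3) := by
  simp only [jEps, jayOf, mul_div_assoc]

theorem continuous_jayOf : Continuous jayOf := by
  rw [continuous_iff_continuousAt]
  intro t
  have hlin : Continuous fun t : ℝ => 1 - 49 / 40 * t := by fun_prop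
  by_cases ht : 1 - 49 / 40 * t = 0
  · rw [continuousAt_iff_punctured_nhds]
    have hval : jayOf t = OnePoint.infty := by simp [jayOf, ht]
    rw [hval]
    have hne : ∀ᶠ u in 𝓝[≠] t, 1 - 49 / 40 * u ≠ 0 := by
      filter_upwards [self_mem_nhdsWithin] with u hu h0
      exact hu (by simp only [Set.mem_singleton_iff]; linarith)
    have h1 : Tendsto (fun u : ℝ => 1 - 49 / 40 * u) (𝓝[≠] t) (𝓝[≠] 0) := by
      refine tendsto_nhdsWithin_iff.2 ⟨?_, hne⟩
      simpa [ht] using (hlin.tendsto t).mono_left nhdsWithin_le_nhds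
    have h2 : Tendsto (fun u : ℝ => (12 ^ 3 : ℝ) / (1 - 49 / 40 * u)) (𝓝[≠] t)
        (coclosedCompact ℝ) := by
      rw [coclosedCompact_eq_cocompact, ← Metric.cobounded_eq_cocompact]
      have h3 := tendsto_inv₀_nhdsNE_zero.comp h1
      have h4 := (tendsto_mul_left_cobounded (a := (12 ^ 3 : ℝ)) (by norm_num)).comp h3
      exact h4.congr fun u => by simp [div_eq_mul_inv]
    refine (OnePoint.tendsto_coe_infty.comp h2).congr' ?_
    filter_upwards [hne] with u hu
    simp [jayOf, hu]
  · have hcont : ContinuousAt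
        (fun u : ℝ => (((12 ^ 3 : ℝ) / (1 - 49 / 40 * u) : ℝ) : OnePoint ℝ)) t :=
      OnePoint.continuous_coe.continuousAt.comp
        (continuousAt_const.div hlin.continuousAt ht)
    refine hcont.congr ?_
    filter_upwards [hlin.continuousAt.eventually_ne ht] with u hu
    simp [jayOf, hu]

namespace IsQuadUnit

variable {θ η : ℝ} {a σ : ℤ}

theorem norm_eq (h : IsQuadUnit θ η a σ) (p : ℤ × ℤ) :
    linForm η p * linForm θ p = ((p.1 ^ 2 - a * p.1 * p.2 + σ * p.2 ^ 2 : ℤ) : ℝ) := by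
  push_cast [linForm]
  rw [← h.add_conj, ← h.mul_conj]
  ring

theorem pos (h : IsQuadUnit θ η a σ) : 0 < θ := zero_lt_one.trans h.one_lt

theorem linForm_eq_zero (h : IsQuadUnit θ η a σ) {p : ℤ × ℤ} (hp : linForm θ p = 0) :
    p = 0 := by
  have h2 : p.2 = 0 := h.irrational p.1 p.2 (by unfold linForm at hp; linarith)
  have h1 : (p.1 : ℝ) = 0 := by simpa [linForm, h2] using hp
  exact Prod.ext (by exact_mod_cast h1) h2

theorem linForm_conj_eq_zero (h : IsQuadUnit θ η a σ) {p : ℤ × ℤ} (hp : linForm η p = 0) :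
    p = 0 := by
  have hη : η = a - θ := by linarith [h.add_conj]
  have h2 : p.2 = 0 := h.irrational (p.2 * a - p.1) p.2 (by
    unfold linForm at hp; push_cast; rw [hη] at hp; linarith)
  have h1 : (p.1 : ℝ) = 0 := by simpa [linForm, h2] using hp
  exact Prod.ext (by exact_mod_cast h1) h2

theorem one_le_abs_mul (h : IsQuadUnit θ η a σ) {p : ℤ × ℤ} (hp : p ≠ 0) :
    1 ≤ |linForm η p| * |linForm θ p| := by
  have hne : linForm η p * linForm θ p ≠ 0 :=
    mul_ne_zero (fun h0 => hp (h.linForm_conj_eq_zero h0)) (fun h0 => hp (h.linForm_eq_zero h0))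
  rw [← abs_mul]
  rw [h.norm_eq] at hne ⊢
  exact_mod_cast Int.one_le_abs (by exact_mod_cast hne)

theorem abs_norm (h : IsQuadUnit θ η a σ) : |(σ : ℝ)| = 1 := by
  have : (σ : ℝ) ^ 2 = 1 := by exact_mod_cast h.sq_norm
  exact (pow_eq_one_iff_of_nonneg (abs_nonneg _) two_ne_zero).1 (by rw [sq_abs]; exact this)

theorem abs_conj (h : IsQuadUnit θ η a σ) : |η| = θ⁻¹ := by
  have h1 : θ * |η| = 1 := by
    rw [← h.abs_norm, ← h.mul_conj, abs_mul, abs_of_pos h.pos]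
  exact eq_inv_of_mul_eq_one_right h1

theorem sub_pos (h : IsQuadUnit θ η a σ) : 0 < θ - η := by
  have h1 : θ⁻¹ < 1 := inv_lt_one_of_one_lt₀ h.one_lt
  have := le_abs_self η
  rw [h.abs_conj] at this
  linarith [h.one_lt]

theorem linForm_sub (p : ℤ × ℤ) : linForm η p - linForm θ p = p.2 * (θ - η) := by
  unfold linForm; ring

theorem abs_linForm_le (h : IsQuadUnit θ η a σ) {r : ℝ} {p : ℤ × ℤ}
    (hp : p ∈ strip θ η r) : |linForm θ p| ≤ r ^ 2 * linForm η p := by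
  obtain ⟨h1, h2⟩ := hp
  have h0 : p ≠ 0 := by rintro rfl; simp [linForm] at h2
  have h3 := h.one_le_abs_mul h0
  rw [abs_of_pos h2] at h3
  have h4 := abs_nonneg (linForm θ p)
  have h5 : |linForm θ p| ^ 2 ≤ r ^ 2 := pow_le_pow_left₀ h4 h1.le 2
  nlinarith [mul_le_mul_of_nonneg_right h5 h2.le, mul_le_mul_of_nonneg_left h3 h4]

theorem mul_sub_bounds (h : IsQuadUnit θ η a σ) {r : ℝ} {p : ℤ × ℤ}
    (hp : p ∈ strip θ η r) :
    (1 - r ^ 2) * linForm η p ≤ p.2 * (θ - η) ∧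
      p.2 * (θ - η) ≤ (1 + r ^ 2) * linForm η p := by
  have h1 := abs_le.1 (h.abs_linForm_le hp)
  rw [← linForm_sub]
  constructor <;> nlinarith

theorem snd_pos (h : IsQuadUnit θ η a σ) {r : ℝ} (hr : r ^ 2 < 1) {p : ℤ × ℤ}
    (hp : p ∈ strip θ η r) : 0 < p.2 := by
  have h1 := (h.mul_sub_bounds hp).1
  have h2 : 0 < (1 - r ^ 2) * linForm η p := mul_pos (by linarith) hp.2
  have h3 : (0 : ℝ) < p.2 := pos_of_mul_pos_left (h2.trans_le h1) h.sub_pos.le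
  exact_mod_cast h3

theorem injOn_snd {r : ℝ} (hr : r ≤ 1 / 2) : Set.InjOn Prod.snd (strip θ η r) := by
  rintro p ⟨hp, -⟩ q ⟨hq, -⟩ hpq
  have hpq' : p.2 = q.2 := hpq
  rw [abs_lt] at hp hq
  unfold linForm at hp hq
  rw [hpq'] at hp
  have h1 : (p.1 : ℝ) < q.1 + 1 := by linarith
  have h2 : (q.1 : ℝ) < p.1 + 1 := by linarith
  have h3 : p.1 < q.1 + 1 := by exact_mod_cast h1
  have h4 : q.1 < p.1 + 1 := by exact_mod_cast h2
  exact Prod.ext (by omega) hpq'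

theorem rpow_neg_bounds (h : IsQuadUnit θ η a σ) {r s : ℝ} (hr : r ^ 2 < 1) (hs : 0 < s)
    {p : ℤ × ℤ} (hp : p ∈ strip θ η r) :
    (1 + r ^ 2) ^ (-s) * linForm η p ^ (-s) ≤ (p.2 : ℝ) ^ (-s) * (θ - η) ^ (-s) ∧
      (p.2 : ℝ) ^ (-s) * (θ - η) ^ (-s) ≤ (1 - r ^ 2) ^ (-s) * linForm η p ^ (-s) := by
  have hn : (0 : ℝ) < p.2 := by exact_mod_cast h.snd_pos hr hp
  have hV := hp.2
  have h1 : 0 < 1 - r ^ 2 := by linarith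
  have h2 : 0 < 1 + r ^ 2 := by positivity
  rw [← Real.mul_rpow h2.le hV.le, ← Real.mul_rpow h1.le hV.le,
    ← Real.mul_rpow hn.le h.sub_pos.le]
  exact ⟨Real.rpow_le_rpow_of_nonpos (mul_pos hn h.sub_pos) (h.mul_sub_bounds hp).2 (by linarith),
    Real.rpow_le_rpow_of_nonpos (mul_pos h1 hV) (h.mul_sub_bounds hp).1 (by linarith)⟩

theorem summable_snd {s : ℝ} (hs : 1 < s) {r : ℝ} (hr : r ≤ 1 / 2) :
    Summable fun p : strip θ η r => |((p : ℤ × ℤ).2 : ℝ)| ^ (-s) :=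
  (Real.summable_abs_int_rpow hs).comp_injective (Set.injOn_iff_injective.1 (injOn_snd hr))

theorem indicator_nonneg (S : Set (ℤ × ℤ)) (hS : ∀ p ∈ S, 0 < linForm η p) (s : ℝ) (p : ℤ × ℤ) :
    0 ≤ S.indicator (fun p => linForm η p ^ (-s)) p :=
  Set.indicator_nonneg (fun p hp => Real.rpow_nonneg (hS p hp).le _) p

theorem summable_strip (h : IsQuadUnit θ η a σ) {s : ℝ} (hs : 1 < s) {r : ℝ}
    (hr : r ^ 2 < 1) (hr' : r ≤ 1 / 2) :
    Summable fun p : strip θ η r => linForm η (p : ℤ × ℤ) ^ (-s) := by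
  refine Summable.of_nonneg_of_le (fun p => Real.rpow_nonneg p.2.2.le _) (fun p => ?_)
    ((summable_snd hs hr').mul_left (((1 + r ^ 2) ^ (-s))⁻¹ * (θ - η) ^ (-s)))
  have h1 := (h.rpow_neg_bounds hr (zero_lt_one.trans hs) p.2).1
  have hn : (0 : ℝ) < (p : ℤ × ℤ).2 := by exact_mod_cast h.snd_pos hr p.2
  have hc : (0 : ℝ) < (1 + r ^ 2) ^ (-s) := by positivity
  rw [abs_of_pos hn, mul_assoc, ← div_eq_inv_mul, le_div_iff₀ hc]
  linarith

theorem summable_indicator (h : IsQuadUnit θ η a σ) {s : ℝ} (hs : 1 < s) :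
    Summable ((strip θ η (1 / 2)).indicator fun p => linForm η p ^ (-s)) :=
  summable_subtype_iff_indicator.1 (h.summable_strip hs (by norm_num) le_rfl)

/-- Multiplication by `θ` in the coordinates `m - n η`. -/
def mulUnit (h : IsQuadUnit θ η a σ) : ℤ × ℤ ≃ ℤ × ℤ where
  toFun p := (p.1 * a - σ * p.2, p.1)
  invFun p := (p.2, σ * (p.2 * a - p.1))
  left_inv p := Prod.ext rfl (by linear_combination p.2 * h.sq_norm)
  right_inv p := Prod.ext (by linear_combination (p.1 - p.2 * a) * h.sq_norm) rfl

theorem linForm_mulUnit (h : IsQuadUnit θ η a σ) (p : ℤ × ℤ) :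
    linForm θ (h.mulUnit p) = η * linForm θ p := by
  simp only [linForm, mulUnit, Equiv.coe_fn_mk]
  push_cast
  rw [← h.add_conj, ← h.mul_conj]
  ring

theorem linForm_conj_mulUnit (h : IsQuadUnit θ η a σ) (p : ℤ × ℤ) :
    linForm η (h.mulUnit p) = θ * linForm η p := by
  simp only [linForm, mulUnit, Equiv.coe_fn_mk]
  push_cast
  rw [← h.add_conj, ← h.mul_conj]
  ring

theorem mulUnit_mem_strip (h : IsQuadUnit θ η a σ) (r : ℝ) (p : ℤ × ℤ) :
    h.mulUnit p ∈ strip θ η r ↔ p ∈ strip θ η (r * θ) := by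
  simp only [strip, Set.mem_ofPred_eq, linForm_mulUnit, linForm_conj_mulUnit, abs_mul, h.abs_conj,
    mul_pos_iff_of_pos_left h.pos, inv_mul_lt_iff₀ h.pos, mul_comm r]

theorem mulUnit_mem_closedStrip (h : IsQuadUnit θ η a σ) (r : ℝ) (p : ℤ × ℤ) :
    h.mulUnit p ∈ closedStrip θ η r ↔ p ∈ closedStrip θ η (r * θ) := by
  simp only [closedStrip, Set.mem_ofPred_eq, linForm_mulUnit, linForm_conj_mulUnit, abs_mul,
    h.abs_conj, mul_pos_iff_of_pos_left h.pos, inv_mul_le_iff₀ h.pos, mul_comm r]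

theorem zetaOn_scale (h : IsQuadUnit θ η a σ) {S S' : Set (ℤ × ℤ)}
    (hS : ∀ p ∈ S, 0 < linForm η p) (hSS' : ∀ p, h.mulUnit p ∈ S' ↔ p ∈ S) (s : ℝ) :
    zetaOn η S' s = θ ^ (-s) * zetaOn η S s := by
  unfold zetaOn
  rw [← h.mulUnit.tsum_eq, ← tsum_mul_left]
  congr 1
  ext p
  by_cases hp : p ∈ S
  · rw [Set.indicator_of_mem ((hSS' p).2 hp), Set.indicator_of_mem hp, linForm_conj_mulUnit,
      Real.mul_rpow h.pos.le (hS p hp).le]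
  · rw [Set.indicator_of_notMem (mt (hSS' p).1 hp), Set.indicator_of_notMem hp, mul_zero]

theorem rpow_ratio {c : ℝ} (hc : 0 < c) : (c ^ (-6 : ℝ)) ^ 2 / (c ^ (-4 : ℝ)) ^ 3 = 1 := by
  rw [← Real.rpow_mul_natCast hc.le, ← Real.rpow_mul_natCast hc.le]
  norm_num
  exact inv_mul_cancel₀ (pow_pos hc _).ne'

theorem ratioOn_scale (h : IsQuadUnit θ η a σ) {S S' : Set (ℤ × ℤ)}
    (hS : ∀ p ∈ S, 0 < linForm η p) (hSS' : ∀ p, h.mulUnit p ∈ S' ↔ p ∈ S) :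
    ratioOn η S' = ratioOn η S := by
  rw [ratioOn, h.zetaOn_scale hS hSS', h.zetaOn_scale hS hSS', mul_pow, mul_pow, mul_div_mul_comm,
    rpow_ratio h.pos, one_mul, ratioOn]

theorem comp_mul_zpow {f : ℝ → ℝ} {c : ℝ} (hc : c ≠ 0) (hf : ∀ r, f (r * c) = f r) (r : ℝ)
    (k : ℤ) : f (r * c ^ k) = f r := by
  induction k with
  | zero => simp
  | succ n ih => rw [zpow_add_one₀ hc, ← mul_assoc, hf, ih]
  | pred n ih => rw [← hf, mul_assoc, ← zpow_add_one₀ hc, sub_add_cancel, ih]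

theorem ratioOn_strip_zpow (h : IsQuadUnit θ η a σ) (r : ℝ) (k : ℤ) :
    ratioOn η (strip θ η (r * θ ^ k)) = ratioOn η (strip θ η r) :=
  comp_mul_zpow (f := fun r => ratioOn η (strip θ η r)) h.pos.ne'
    (fun r => (h.ratioOn_scale (fun _ hp => hp.2) (h.mulUnit_mem_strip r)).symm) r k

theorem ratioOn_closedStrip_zpow (h : IsQuadUnit θ η a σ) (r : ℝ) (k : ℤ) :
    ratioOn η (closedStrip θ η (r * θ ^ k)) = ratioOn η (closedStrip θ η r) :=
  comp_mul_zpow (f := fun r => ratioOn η (closedStrip θ η r)) h.pos.ne'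
    (fun r => (h.ratioOn_scale (fun _ hp => hp.2) (h.mulUnit_mem_closedStrip r)).symm) r k

theorem strip_nonempty (h : IsQuadUnit θ η a σ) {r : ℝ} (hr : 0 < r) :
    (strip θ η r).Nonempty := by
  obtain ⟨k, hk⟩ := exists_pow_lt_of_lt_one hr (inv_lt_one_of_one_lt₀ h.one_lt)
  have key : ∀ j : ℕ, |linForm θ (h.mulUnit^[j] (1, 0))| = θ⁻¹ ^ j ∧
      0 < linForm η (h.mulUnit^[j] (1, 0)) := by
    intro j
    induction j with
    | zero => simp [linForm]
    | succ j ih =>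
      rw [Function.iterate_succ_apply', linForm_mulUnit, linForm_conj_mulUnit, abs_mul, ih.1,
        h.abs_conj, pow_succ']
      exact ⟨rfl, mul_pos h.pos ih.2⟩
  exact ⟨_, (key k).1.trans_lt hk, (key k).2⟩

theorem strip_subset_closedStrip (r : ℝ) : strip θ η r ⊆ closedStrip θ η r :=
  fun _ hp => ⟨hp.1.le, hp.2⟩

theorem strip_mono {r r' : ℝ} (hr : r ≤ r') : strip θ η r ⊆ strip θ η r' :=
  fun _ hp => ⟨hp.1.trans_le hr, hp.2⟩

theorem closedStrip_subset {r r' : ℝ} (hr : r < r') : closedStrip θ η r ⊆ strip θ η r' :=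
  fun _ hp => ⟨hp.1.trans_lt hr, hp.2⟩

theorem zetaOn_pos (h : IsQuadUnit θ η a σ) {S : Set (ℤ × ℤ)} {r s : ℝ} (hs : 1 < s)
    (hr : 0 < r) (hrS : strip θ η r ⊆ S) (hS : S ⊆ strip θ η (1 / 2)) : 0 < zetaOn η S s := by
  obtain ⟨p, hp⟩ := h.strip_nonempty hr
  have hsum : Summable (S.indicator fun p => linForm η p ^ (-s)) := by
    have := (h.summable_indicator hs).indicator S
    rwa [Set.indicator_indicator, Set.inter_eq_left.2 hS] at this
  refine hsum.tsum_pos (indicator_nonneg S (fun p hp => (hS hp).2) s) p ?_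
  rw [Set.indicator_of_mem (hrS hp)]
  exact Real.rpow_pos_of_pos hp.2 _

theorem zetaEps_eq (h : IsQuadUnit θ η a σ) {ε : ℝ} (hε : ε ^ 2 < 1) (hε' : ε ≤ 1 / 2)
    (hεD : ε ≤ θ - η) (s : ℝ) :
    zetaEps θ ε s = ∑' p : strip θ η ε, ((p : ℤ × ℤ).2 : ℝ) ^ (-s) := by
  have hset : {n : ℤ | n ∈ LambdaEps θ ε ∧ 0 < n} = Prod.snd '' strip θ η ε := by
    ext n
    constructor
    · rintro ⟨hn, hn0⟩
      have h1 : |linForm θ (round (n * θ), n)| < ε := by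
        rw [linForm, abs_sub_comm]
        exact hn
      refine ⟨(round (n * θ), n), ⟨h1, ?_⟩, rfl⟩
      have h2 := linForm_sub (θ := θ) (η := η) (round (n * θ), n)
      have h3 : (1 : ℝ) ≤ n := by exact_mod_cast hn0
      have h4 := le_mul_of_one_le_left h.sub_pos.le h3
      have h5 := (abs_lt.1 h1).1
      simp only at h2
      linarith
    · rintro ⟨p, hp, rfl⟩
      refine ⟨?_, h.snd_pos hε hp⟩
      have h1 := hp.1
      rw [linForm, abs_sub_comm] at h1
      exact (round_le _ p.1).trans_lt h1
  exact (tsum_congr_set_coe (fun n : ℤ => (n : ℝ) ^ (-s)) hset).trans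
    (tsum_image (fun n : ℤ => (n : ℝ) ^ (-s)) (injOn_snd hε'))

theorem zetaEps_bounds (h : IsQuadUnit θ η a σ) {ε s : ℝ} (hs : 1 < s) (hε : ε ^ 2 < 1)
    (hε' : ε ≤ 1 / 2) (hεD : ε ≤ θ - η) :
    (1 + ε ^ 2) ^ (-s) * zetaOn η (strip θ η ε) s ≤ zetaEps θ ε s * (θ - η) ^ (-s) ∧
      zetaEps θ ε s * (θ - η) ^ (-s) ≤ (1 - ε ^ 2) ^ (-s) * zetaOn η (strip θ η ε) s := by
  have hs0 := zero_lt_one.trans hs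
  have hV := h.summable_strip hs hε hε'
  have hN : Summable fun p : strip θ η ε => ((p : ℤ × ℤ).2 : ℝ) ^ (-s) := by
    refine (summable_snd hs hε').congr fun p => ?_
    rw [abs_of_pos (by exact_mod_cast h.snd_pos hε p.2)]
  rw [h.zetaEps_eq hε hε' hεD, zetaOn, ← tsum_subtype, ← tsum_mul_right, ← tsum_mul_left,
    ← tsum_mul_left]
  exact ⟨(hV.mul_left _).tsum_le_tsum (fun p => (h.rpow_neg_bounds hε hs0 p.2).1)
    (hN.mul_right _), (hN.mul_right _).tsum_le_tsum
    (fun p => (h.rpow_neg_bounds hε hs0 p.2).2) (hV.mul_left _)⟩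

theorem tendsto_zetaEps_div (h : IsQuadUnit θ η a σ) {s : ℝ} (hs : 1 < s) :
    Tendsto (fun ε => zetaEps θ ε s * (θ - η) ^ (-s) / zetaOn η (strip θ η ε) s)
      (𝓝[>] 0) (𝓝 1) := by
  have hev : ∀ᶠ ε : ℝ in 𝓝[>] 0, 0 < ε ∧ ε ≤ 1 / 2 ∧ ε ≤ θ - η := by
    filter_upwards [Ioc_mem_nhdsGT (show (0 : ℝ) < min (1 / 2) (θ - η) from
      lt_min (by norm_num) h.sub_pos)] with ε hε
    exact ⟨hε.1, hε.2.trans (min_le_left _ _), hε.2.trans (min_le_right _ _)⟩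
  have hlim : ∀ c : ℝ, Tendsto (fun ε : ℝ => (1 + c * ε ^ 2) ^ (-s)) (𝓝[>] 0) (𝓝 1) := by
    intro c
    have h1 : ContinuousAt (fun ε : ℝ => (1 + c * ε ^ 2) ^ (-s)) 0 :=
      ContinuousAt.rpow_const (by fun_prop) (Or.inl (by norm_num))
    simpa using h1.tendsto.mono_left nhdsWithin_le_nhds
  have h1 := hlim 1
  have h2 := hlim (-1)
  refine tendsto_of_tendsto_of_tendsto_of_le_of_le' h1 h2 ?_ ?_
  all_goals
    filter_upwards [hev] with ε hε
    have hsq : ε ^ 2 < 1 := by nlinarith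
    have hb := h.zetaEps_bounds hs hsq hε.2.1 hε.2.2
    have hpos := h.zetaOn_pos hs hε.1 subset_rfl (strip_mono hε.2.1)
  · rw [le_div_iff₀ hpos, one_mul]
    exact hb.1
  · rw [div_le_iff₀ hpos, neg_one_mul, ← sub_eq_add_neg]
    exact hb.2

theorem tendsto_ratio_div (h : IsQuadUnit θ η a σ) :
    Tendsto (fun ε => zetaEps θ ε 6 ^ 2 / zetaEps θ ε 4 ^ 3 / ratioOn η (strip θ η ε))
      (𝓝[>] 0) (𝓝 1) := by
  have h6 := (h.tendsto_zetaEps_div (s := 6) (by norm_num)).pow 2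
  have h4 := (h.tendsto_zetaEps_div (s := 4) (by norm_num)).pow 3
  have hdiv := h6.div h4 (by norm_num)
  simp only [one_pow, div_one] at hdiv
  refine hdiv.congr fun ε => ?_
  have hD := rpow_ratio h.sub_pos
  simp only [Pi.div_apply, div_pow, mul_pow, ratioOn]
  rw [div_div_div_comm, mul_div_mul_comm, hD, mul_one]

theorem tendsto_zetaOn (h : IsQuadUnit θ η a σ) {ι : Type*} {l : Filter ι}
    {S : ι → Set (ℤ × ℤ)} {S₀ : Set (ℤ × ℤ)} (hS : ∀ p, ∀ᶠ i in l, (p ∈ S i ↔ p ∈ S₀))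
    (hsub : ∀ᶠ i in l, S i ⊆ strip θ η (1 / 2)) {s : ℝ} (hs : 1 < s) :
    Tendsto (fun i => zetaOn η (S i) s) l (𝓝 (zetaOn η S₀ s)) := by
  refine tendsto_tsum_of_dominated_convergence (h.summable_indicator hs) (fun p => ?_) ?_
  · refine tendsto_const_nhds.congr' ?_
    filter_upwards [hS p] with i hi
    by_cases hp : p ∈ S₀
    · rw [Set.indicator_of_mem hp, Set.indicator_of_mem (hi.2 hp)]
    · rw [Set.indicator_of_notMem hp, Set.indicator_of_notMem (mt hi.1 hp)]
  · filter_upwards [hsub] with i hi p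
    rw [Real.norm_of_nonneg (indicator_nonneg _ (fun p hp => (hi hp).2) s p)]
    by_cases hp : p ∈ S i
    · rw [Set.indicator_of_mem hp, Set.indicator_of_mem (hi hp)]
    · rw [Set.indicator_of_notMem hp]
      exact indicator_nonneg _ (fun p hp => hp.2) s p

theorem tendsto_ratioOn (h : IsQuadUnit θ η a σ) {ι : Type*} {l : Filter ι}
    {S : ι → Set (ℤ × ℤ)} {S₀ : Set (ℤ × ℤ)} (hS : ∀ p, ∀ᶠ i in l, (p ∈ S i ↔ p ∈ S₀))
    (hsub : ∀ᶠ i in l, S i ⊆ strip θ η (1 / 2)) (hne : zetaOn η S₀ 4 ≠ 0) :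
    Tendsto (fun i => ratioOn η (S i)) l (𝓝 (ratioOn η S₀)) :=
  ((h.tendsto_zetaOn hS hsub (by norm_num)).pow 2).div
    ((h.tendsto_zetaOn hS hsub (by norm_num)).pow 3) (pow_ne_zero 3 hne)

theorem tendsto_ratioOn_strip_of_le (h : IsQuadUnit θ η a σ) {ι : Type*} {l : Filter ι}
    {ρ : ι → ℝ} {r : ℝ} (hr0 : 0 < r) (hr : r < 1 / 2) (hρ : Tendsto ρ l (𝓝 r))
    (hle : ∀ᶠ i in l, ρ i ≤ r) :
    Tendsto (fun i => ratioOn η (strip θ η (ρ i))) l (𝓝 (ratioOn η (strip θ η r))) := by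
  refine h.tendsto_ratioOn (fun p => ?_) ?_
    (h.zetaOn_pos (by norm_num) hr0 subset_rfl (strip_mono hr.le)).ne'
  · by_cases hp : |linForm θ p| < r
    · filter_upwards [hρ.eventually_const_lt hp] with i hi
      simp [strip, hp, hi]
    · filter_upwards [hle] with i hi
      have hi' : ¬ |linForm θ p| < ρ i := fun hlt => hp (hlt.trans_le hi)
      simp [strip, hp, hi']
  · filter_upwards [hle] with i hi
    exact strip_mono (hi.trans hr.le)

theorem tendsto_ratioOn_strip_of_gt (h : IsQuadUnit θ η a σ) {ι : Type*} {l : Filter ι}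
    {ρ : ι → ℝ} {r : ℝ} (hr0 : 0 < r) (hr : r < 1 / 2) (hρ : Tendsto ρ l (𝓝 r))
    (hlt : ∀ᶠ i in l, r < ρ i) :
    Tendsto (fun i => ratioOn η (strip θ η (ρ i))) l
      (𝓝 (ratioOn η (closedStrip θ η r))) := by
  refine h.tendsto_ratioOn (fun p => ?_) ?_ (h.zetaOn_pos (by norm_num) hr0
    (strip_subset_closedStrip r) (closedStrip_subset hr)).ne'
  · by_cases hp : |linForm θ p| ≤ r
    · filter_upwards [hlt] with i hi
      simp [strip, closedStrip, hp, hp.trans_lt hi]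
    · filter_upwards [hρ.eventually_lt_const (not_le.1 hp)] with i hi
      simp [strip, closedStrip, hp, hi.le]
  · filter_upwards [hρ.eventually_lt_const hr] with i hi
    exact strip_mono hi.le

theorem tendsto_jEps (h : IsQuadUnit θ η a σ) {ι : Type*} {l : Filter ι} {ε ρ : ι → ℝ}
    {k : ι → ℤ} {q : ℝ} (hε : Tendsto ε l (𝓝[>] 0)) (hk : ∀ᶠ i in l, ε i = ρ i * θ ^ k i)
    (hq : Tendsto (fun i => ratioOn η (strip θ η (ρ i))) l (𝓝 q)) :
    Tendsto (fun i => jEps θ (ε i)) l (𝓝 (jayOf q)) := by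
  have h1 := (h.tendsto_ratio_div.comp hε).mul hq
  rw [one_mul] at h1
  refine ((continuous_jayOf.tendsto q).comp h1).congr' ?_
  have hsmall : ∀ᶠ i in l, ε i ∈ Set.Ioc (0 : ℝ) (1 / 2) :=
    hε.eventually (Ioc_mem_nhdsGT (by norm_num))
  filter_upwards [hk, hsmall] with i hi hi'
  have hpos : ∀ s : ℝ, 1 < s → 0 < zetaOn η (strip θ η (ε i)) s := fun s hs =>
    h.zetaOn_pos hs hi'.1 subset_rfl (strip_mono hi'.2)
  have hne : ratioOn η (strip θ η (ε i)) ≠ 0 :=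
    div_ne_zero (pow_ne_zero 2 (hpos 6 (by norm_num)).ne')
      (pow_ne_zero 3 (hpos 4 (by norm_num)).ne')
  have heq : ratioOn η (strip θ η (ρ i)) = ratioOn η (strip θ η (ε i)) := by
    rw [hi, h.ratioOn_strip_zpow]
  simp only [Function.comp_apply]
  rw [jEps_eq, heq, div_mul_cancel₀ _ hne]

theorem exists_rpow_mul_zpow (h : IsQuadUnit θ η a σ) {r : ℝ} (hr : 0 < r) :
    ∃ x ∈ Set.Ico (0 : ℝ) 1, ∃ k : ℤ, r = θ ^ (-x) * θ ^ k := by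
  refine ⟨Int.fract (-Real.logb θ r), ⟨Int.fract_nonneg _, Int.fract_lt_one _⟩,
    -⌊-Real.logb θ r⌋, ?_⟩
  rw [← Real.rpow_intCast, ← Real.rpow_add h.pos]
  have : -Int.fract (-Real.logb θ r) + ((-⌊-Real.logb θ r⌋ : ℤ) : ℝ) = Real.logb θ r := by
    push_cast
    linarith [Int.fract_add_floor (-Real.logb θ r)]
  rw [this, Real.rpow_logb h.pos h.one_lt.ne' hr]

theorem mem_jqt_of_tendsto (h : IsQuadUnit θ η a σ) {ρ : ℕ → ℝ} {r q : ℝ}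
    (hρ : Tendsto ρ atTop (𝓝 r)) (hρ0 : ∀ i, 0 < ρ i)
    (hq : Tendsto (fun i => ratioOn η (strip θ η (ρ i))) atTop (𝓝 q)) :
    jayOf q ∈ jqt θ := by
  have hpow : Tendsto (fun i : ℕ => θ⁻¹ ^ i) atTop (𝓝 0) :=
    tendsto_pow_atTop_nhds_zero_of_lt_one (inv_nonneg.2 h.pos.le)
      (inv_lt_one_of_one_lt₀ h.one_lt)
  have hε : Tendsto (fun i => ρ i * θ⁻¹ ^ i) atTop (𝓝[>] 0) := by
    refine tendsto_nhdsWithin_iff.2 ⟨by simpa using hρ.mul hpow, Eventually.of_forall fun i => ?_⟩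
    exact mul_pos (hρ0 i) (pow_pos (inv_pos.2 h.pos) i)
  have := h.tendsto_jEps (k := fun i : ℕ => -(i : ℤ)) hε (Eventually.of_forall fun i => by simp) hq
  exact MapClusterPt.of_comp hε this.mapClusterPt

theorem jqt_eq (h : IsQuadUnit θ η a σ) :
    jqt θ = (fun x => jayOf (ratioOn η (strip θ η (θ ^ (-x))))) '' Set.Ico (0 : ℝ) 1 ∪
      (fun x => jayOf (ratioOn η (closedStrip θ η (θ ^ (-x))))) '' Set.Ico (0 : ℝ) 1 := by
  ext y
  constructor
  · intro hy
    obtain ⟨U, hU, hUy⟩ := mapClusterPt_iff_ultrafilter.1 hy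
    have hex : ∀ ε : ℝ, ∃ ρ ∈ Set.Icc (1 / 4 * θ⁻¹) (1 / 4), ∃ k : ℤ, 0 < ε → ε = ρ * θ ^ k := by
      intro ε
      by_cases hε : 0 < ε
      · obtain ⟨x, hx, k, hk⟩ := h.exists_rpow_mul_zpow (show 0 < 4 * ε by linarith)
        refine ⟨1 / 4 * θ ^ (-x), ⟨?_, ?_⟩, k, fun _ => by linarith⟩
        · rw [← Real.rpow_neg_one]
          have := Real.rpow_le_rpow_of_exponent_le h.one_lt.le (neg_le_neg hx.2.le)
          linarith
        · have := Real.rpow_le_one_of_one_le_of_nonpos h.one_lt.le (neg_nonpos.2 hx.1)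
          linarith
      · have := inv_lt_one_of_one_lt₀ h.one_lt
        exact ⟨1 / 4, ⟨by linarith, le_rfl⟩, 0, fun h0 => absurd h0 hε⟩
    choose ρ hρ k hk using hex
    have hkU : ∀ᶠ ε in (U : Filter ℝ), ε = ρ ε * θ ^ k ε :=
      hU (by filter_upwards [self_mem_nhdsWithin] with ε hε using hk ε hε)
    obtain ⟨r, hr, hrU⟩ := (isCompact_Icc (a := 1 / 4 * θ⁻¹) (b := 1 / 4)).ultrafilter_le_nhds
      (U.map ρ) (le_principal_iff.2 (Eventually.of_forall hρ :
        ∀ᶠ ε in (U : Filter ℝ), ρ ε ∈ Set.Icc (1 / 4 * θ⁻¹) (1 / 4)))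
    have hr0 : 0 < r := lt_of_lt_of_le (mul_pos (by norm_num) (inv_pos.2 h.pos)) hr.1
    have hr2 : r < 1 / 2 := by linarith [hr.2]
    obtain ⟨x, hx, m, hm⟩ := h.exists_rpow_mul_zpow hr0
    rcases Ultrafilter.eventually_or.1 (Eventually.of_forall fun ε => le_or_gt (ρ ε) r :
      ∀ᶠ ε in (U : Filter ℝ), ρ ε ≤ r ∨ r < ρ ε) with hle | hlt
    · refine Or.inl ⟨x, hx, ?_⟩
      have hlim := h.tendsto_jEps hU hkU (h.tendsto_ratioOn_strip_of_le hr0 hr2 hrU hle)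
      rw [tendsto_nhds_unique hUy hlim, hm, h.ratioOn_strip_zpow]
    · refine Or.inr ⟨x, hx, ?_⟩
      have hlim := h.tendsto_jEps hU hkU (h.tendsto_ratioOn_strip_of_gt hr0 hr2 hrU hlt)
      rw [tendsto_nhds_unique hUy hlim, hm, h.ratioOn_closedStrip_zpow]
  · have hsmall : ∀ x : ℝ, ∃ n : ℤ, θ ^ (-x) * θ ^ n < 1 / 2 := by
      intro x
      have hx : 0 < θ ^ (-x) := Real.rpow_pos_of_pos h.pos _
      obtain ⟨n, hn⟩ := exists_pow_lt_of_lt_one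
        (show 0 < 1 / 2 / θ ^ (-x) by positivity) (inv_lt_one_of_one_lt₀ h.one_lt)
      refine ⟨-n, ?_⟩
      rw [lt_div_iff₀ hx, mul_comm] at hn
      simpa using hn
    rintro (⟨x, -, rfl⟩ | ⟨x, -, rfl⟩) <;> obtain ⟨n, hn⟩ := hsmall x <;>
      have hr0 : 0 < θ ^ (-x) * θ ^ n :=
        mul_pos (Real.rpow_pos_of_pos h.pos _) (zpow_pos h.pos n)
    · simp only
      rw [← h.ratioOn_strip_zpow _ n]
      exact h.mem_jqt_of_tendsto tendsto_const_nhds (fun _ => hr0) tendsto_const_nhds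
    · simp only
      rw [← h.ratioOn_closedStrip_zpow _ n]
      have hρ : Tendsto (fun i : ℕ => θ ^ (-x) * θ ^ n + 1 / ((i : ℝ) + 1)) atTop
          (𝓝 (θ ^ (-x) * θ ^ n)) := by
        simpa using tendsto_const_nhds.add (tendsto_one_div_add_atTop_nhds_zero_nat (𝕜 := ℝ))
      have hgt : ∀ i : ℕ, θ ^ (-x) * θ ^ n < θ ^ (-x) * θ ^ n + 1 / ((i : ℝ) + 1) := fun i =>
        lt_add_of_pos_right _ (by positivity)
      exact h.mem_jqt_of_tendsto hρ (fun i => hr0.trans (hgt i))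
        (h.tendsto_ratioOn_strip_of_gt hr0 hn hρ (Eventually.of_forall hgt))

theorem injective_linForm_conj (h : IsQuadUnit θ η a σ) : Function.Injective (linForm η) := by
  intro p q hpq
  refine sub_eq_zero.1 (h.linForm_conj_eq_zero (p := p - q) ?_)
  unfold linForm at hpq ⊢
  push_cast [Prod.fst_sub, Prod.snd_sub]
  linarith

theorem jaySet_image (h : IsQuadUnit θ η a σ) (P : Set (ℤ × ℤ)) :
    jaySet (linForm η '' P) = jayOf (ratioOn η {p | p ∈ P ∧ 0 < linForm η p}) := by
  have hset : {t : ℝ | t ∈ linForm η '' P ∧ 0 < t} =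
      linForm η '' {p | p ∈ P ∧ 0 < linForm η p} := by
    ext t
    constructor
    · rintro ⟨⟨p, hp, rfl⟩, h0⟩
      exact ⟨p, ⟨hp, h0⟩, rfl⟩
    · rintro ⟨p, ⟨hp, h0⟩, rfl⟩
      exact ⟨⟨p, hp, rfl⟩, h0⟩
  have hz : ∀ s, zSet (linForm η '' P) s = zetaOn η {p | p ∈ P ∧ 0 < linForm η p} s := by
    intro s
    rw [zetaOn, ← tsum_subtype]
    exact (tsum_congr_set_coe (fun t : ℝ => t ^ (-s)) hset).trans
      (tsum_image (fun t : ℝ => t ^ (-s)) h.injective_linForm_conj.injOn)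
  rw [jaySet_eq, hz, hz, ratioOn]

end IsQuadUnit

/-- Elements of `ℤ[t]` with `t` quadratic integral are of the form `m - n t'`. -/
theorem exists_coords {R : Type*} [CommRing R] {t t' : R} {a b : ℤ} (ha : t + t' = a)
    (hb : t * t' = b) {x : R} (hx : x ∈ Algebra.adjoin ℤ {t}) : ∃ m n : ℤ, x = m - n * t' := by
  induction hx using Algebra.adjoin_induction with
  | mem x hx =>
    obtain rfl : x = t := hx
    exact ⟨a, 1, by push_cast; linear_combination ha⟩
  | algebraMap r => exact ⟨r, 0, by simp⟩
  | add x y _ _ hx hy =>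
    obtain ⟨m, n, rfl⟩ := hx
    obtain ⟨m', n', rfl⟩ := hy
    exact ⟨m + m', n + n', by push_cast; ring⟩
  | mul x y _ _ hx hy =>
    obtain ⟨m, n, rfl⟩ := hx
    obtain ⟨m', n', rfl⟩ := hy
    refine ⟨m * m' - n * n' * b, m * n' + m' * n - n * n' * a, ?_⟩
    push_cast
    rw [← ha, ← hb]
    ring

section Field

variable (K : Type*) [Field K] [NumberField K]

/-- An automorphism fixing a generator of the ring of integers is trivial. -/
theorem eq_refl_of_map_eq (g : K ≃+* K) {t : K} (hgen : ∀ α : 𝓞 K, (α : K) ∈ Algebra.adjoin ℤ {t})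
    (ht : g t = t) : g = RingEquiv.refl K := by
  have hint : ∀ α : 𝓞 K, g α = α := by
    intro α
    refine Algebra.adjoin_induction (p := fun x _ => g x = x) ?_ ?_ ?_ ?_ (hgen α)
    · rintro x rfl
      exact ht
    · intro r
      simp
    · intro x y _ _ hx hy
      rw [map_add, hx, hy]
    · intro x y _ _ hx hy
      rw [map_mul, hx, hy]
  ext x
  obtain ⟨α, β, -, rfl⟩ := IsFractionRing.div_surjective (A := 𝓞 K) x
  simpa [map_div₀] using congrArg₂ (· / ·) (hint α) (hint β)

variable {K}

/-- The conjugates of an integer moved by `g` in a quadratic field have integral trace and norm. -/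
theorem exists_trace_norm (hdeg : Module.finrank ℚ K = 2) (g : K ≃+* K) (t : 𝓞 K)
    (ht : g t ≠ t) : ∃ a b : ℤ, (t : K) + g t = a ∧ (t : K) * g t = b := by
  have htint : IsIntegral ℤ (t : K) := t.2
  set P := minpoly ℤ (t : K) with hP
  have hmonic : P.Monic := minpoly.monic htint
  have hle : P.natDegree ≤ 2 := by
    have h1 := minpoly.natDegree_le (A := ℚ) (t : K)
    rwa [hdeg, minpoly.isIntegrallyClosed_eq_field_fractions' ℚ htint,
      hmonic.natDegree_map] at h1
  have hroot : Polynomial.aeval (t : K) P = 0 := minpoly.aeval ℤ (t : K)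
  rw [Polynomial.aeval_eq_sum_range' (n := 3) (by omega)] at hroot
  simp only [Finset.sum_range_succ, Finset.sum_range_zero, zero_add, pow_zero, pow_one,
    zsmul_eq_mul, mul_one] at hroot
  have hne : g t - t ≠ 0 := sub_ne_zero.2 ht
  have hroot' := congrArg g hroot
  simp only [map_add, map_mul, map_pow, map_intCast, map_zero] at hroot'
  have hfac : (P.coeff 1 : K) + P.coeff 2 * (t + g t) = 0 := by
    refine (mul_eq_zero.1 ?_).resolve_left hne
    linear_combination hroot' - hroot
  have hdeg2 : P.natDegree = 2 := by
    by_contra hd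
    have h2 : P.coeff 2 = 0 := Polynomial.coeff_eq_zero_of_natDegree_lt (by omega)
    have h1 : P.coeff 1 = 0 := by simpa [h2] using hfac
    have h0 : P.natDegree = 0 := by
      by_contra h0
      have h3 : P.natDegree = 1 := by omega
      have := hmonic.coeff_natDegree
      rw [h3, h1] at this
      exact zero_ne_one this
    have : 0 < P.natDegree := minpoly.natDegree_pos htint
    omega
  have h2 : P.coeff 2 = 1 := by rw [← hdeg2]; exact hmonic.coeff_natDegree
  rw [h2] at hfac hroot
  refine ⟨-P.coeff 1, P.coeff 0, ?_, ?_⟩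
  · push_cast
    linear_combination hfac
  · push_cast at hfac hroot ⊢
    linear_combination t * hfac - hroot

variable (K)

theorem exists_isQuadUnit (hdeg : Module.finrank ℚ K = 2) (ι : K →+* ℝ) (g : K ≃+* K)
    (hg : g ≠ RingEquiv.refl K) (θu : (𝓞 K)ˣ) (hθ : 1 < ι ((θu : 𝓞 K) : K))
    (hgen : ∀ α : 𝓞 K, (α : K) ∈ Algebra.adjoin ℤ ({((θu : 𝓞 K) : K)} : Set K)) :
    ∃ a σ : ℤ, IsQuadUnit (ι ((θu : 𝓞 K) : K)) (ι (g ((θu : 𝓞 K) : K))) a σ := by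
  set t : K := ((θu : 𝓞 K) : K) with ht
  have hgt : g t ≠ t := fun h => hg (eq_refl_of_map_eq K g hgen h)
  obtain ⟨a, b, ha, hb⟩ := exists_trace_norm hdeg g (θu : 𝓞 K) hgt
  have hgg : g (g t) = t := by
    have := congrArg g ha
    rw [map_add, map_intCast] at this
    linear_combination this - ha
  have hunit : b ^ 2 = 1 := by
    set u : K := ((↑θu⁻¹ : 𝓞 K) : K) with hu
    have htu : t * u = 1 := by
      rw [ht, hu, ← map_mul, Units.mul_inv, map_one]
    obtain ⟨m, n, hmn⟩ := exists_coords ha hb (hgen (↑θu⁻¹ : 𝓞 K))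
    have hgu : g u = m - n * t := by
      rw [hu, hmn, map_sub, map_mul, map_intCast, map_intCast, hgg]
    have hguu : g t * g u = 1 := by rw [← map_mul, htu, map_one]
    have hK : ((b * (m ^ 2 - m * n * a + n ^ 2 * b) : ℤ) : K) = 1 := by
      have : u * g u = ((m ^ 2 - m * n * a + n ^ 2 * b : ℤ) : K) := by
        rw [hgu, hu, hmn]
        push_cast
        rw [← ha, ← hb]
        ring
      rw [Int.cast_mul, ← this, ← hb]
      linear_combination htu * (g t * g u) + hguu
    have hZ : b * (m ^ 2 - m * n * a + n ^ 2 * b) = 1 := by exact_mod_cast hK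
    rcases Int.isUnit_iff.1 (IsUnit.of_mul_eq_one _ hZ) with h | h <;> simp [h]
  refine ⟨a, b, hθ, ?_, ?_, hunit, ?_⟩
  · rw [← map_add, ha, map_intCast]
  · rw [← map_mul, hb, map_intCast]
  · intro m n hmn
    by_contra hn
    have hK : (m : K) = n * t := ι.injective (by simpa using hmn)
    have hgK := congrArg g hK
    simp only [map_mul, map_intCast] at hgK
    have hn' : (n : K) ≠ 0 := by exact_mod_cast hn
    exact hgt (mul_left_cancel₀ hn' (hgK.symm.trans hK))

theorem setOf_eq_image (ι : K →+* ℝ) (g : K ≃+* K) {t : 𝓞 K} {a σ : ℤ}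
    (hq : IsQuadUnit (ι t) (ι (g t)) a σ)
    (hgen : ∀ α : 𝓞 K, (α : K) ∈ Algebra.adjoin ℤ ({(t : K)} : Set K)) (P : ℝ → Prop) :
    {r : ℝ | ∃ α : 𝓞 K, ι (α : K) = r ∧ P (ι (g (α : K)))} =
      linForm (ι (g t)) '' {p | P (linForm (ι t) p)} := by
  have ha : (t : K) + g t = a := ι.injective (by simpa using hq.add_conj)
  have hb : (t : K) * g t = σ := ι.injective (by simpa using hq.mul_conj)
  have hgg : g (g t) = t := by
    have := congrArg g ha
    rw [map_add, map_intCast] at this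
    linear_combination this - ha
  have hconj : ∀ (x : K) (m n : ℤ), x = m - n * g t →
      ι x = linForm (ι (g t)) (m, n) ∧ ι (g x) = linForm (ι t) (m, n) := by
    rintro x m n rfl
    simp [linForm, hgg]
  ext r
  constructor
  · rintro ⟨α, rfl, hα⟩
    obtain ⟨m, n, hmn⟩ := exists_coords ha hb (hgen α)
    obtain ⟨h1, h2⟩ := hconj _ m n hmn
    rw [h2] at hα
    exact ⟨(m, n), hα, h1.symm⟩
  · rintro ⟨⟨m, n⟩, hp, rfl⟩
    obtain ⟨h1, h2⟩ := hconj ((((m - n * a : ℤ) : 𝓞 K) + n * t : 𝓞 K) : K) m n (by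
      simp only [map_add, map_mul, map_intCast]
      push_cast
      linear_combination (n : K) * ha)
    exact ⟨_, h1, by rw [h2]; exact hp⟩

end Field

/-- (Pink) For a fundamental unit `θ > 1` of a real quadratic field `K = ℚ(θ)` with
`O_K = ℤ[θ]`, the quantum modular invariant `j^qt(θ)` is exactly the set of quasicrystalline
modular invariants `j(𝔞_x)`, `j(𝔞_x⁺)` for `x ∈ [0,1)`. -/
theorem stmt14 (K : Type*) [Field K] [NumberField K]
    (hdeg : Module.finrank ℚ K = 2) (ι : K →+* ℝ)
    (g : K ≃+* K) (hg : g ≠ RingEquiv.refl K)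
    (θu : (𝓞 K)ˣ) (hθ : 1 < ι ((θu : 𝓞 K) : K))
    -- `θ` is a fundamental unit …
    (hfund : ∀ v : (𝓞 K)ˣ, ∃ n : ℤ, ((v : 𝓞 K) : K) = (((θu ^ n : (𝓞 K)ˣ) : 𝓞 K) : K)
      ∨ ((v : 𝓞 K) : K) = -(((θu ^ n : (𝓞 K)ˣ) : 𝓞 K) : K))
    -- … and `O_K = ℤ[θ]`
    (hgen : ∀ α : 𝓞 K, (α : K) ∈ Algebra.adjoin ℤ ({((θu : 𝓞 K) : K)} : Set K)) :
    jqt (ι ((θu : 𝓞 K) : K)) =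
      (fun x => jaySet (aQC K ι g (ι ((θu : 𝓞 K) : K)) x)) '' Set.Ico (0 : ℝ) 1 ∪
      (fun x => jaySet (aQCplus K ι g (ι ((θu : 𝓞 K) : K)) x)) '' Set.Ico (0 : ℝ) 1 := by
  obtain ⟨a, σ, hq⟩ := exists_isQuadUnit K hdeg ι g hg θu hθ hgen
  rw [hq.jqt_eq]
  congr 1
  · refine Set.image_congr fun x _ => ?_
    rw [aQC, setOf_eq_image K ι g hq hgen (fun u => |u| < _), hq.jaySet_image]
    rfl
  · refine Set.image_congr fun x _ => ?_
    rw [aQCplus, setOf_eq_image K ι g hq hgen (fun u => |u| ≤ _), hq.jaySet_image]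
    rfl
end
end

section
/- Let 𝔞 = 𝔞_{𝔄,x} := {α ∈ 𝔄 : |α′| < θ^{−x}} be a rank-1 quasicrystalline model ideal, where 𝔄 is a fractional ideal of O_K and x ∈ ℝ. Define the entire function s_𝔞(z) := z·∏_{α∈𝔞, α>0}(1 − z²/α²) (the product converges locally uniformly on ℂ since Σ_{α>0} α^{−2} < ∞) and c_𝔞 := s_𝔞′. Then: (i) the set 𝔟 := {β ∈ ℝ : c_𝔞(β) = 0} of real zeros of c_𝔞 is a Delaunay set; (ii) listing the positive elements of 𝔞 as 0 < α₁ < α₂ < ⋯ and of 𝔟 as 0 < β₁ < β₂ < ⋯, the zeros interlace: 0 < β₁ < α₁ < β₂ < α₂ < ⋯ (exactly one element of 𝔟 lies strictly between consecutive elements of {0} ∪ {αₙ}); and (iii) c_𝔞 admits the product representation c_𝔞(z) = ∏_{β∈𝔟, β>0}(1 − z²/β²) for all z ∈ ℂ. -/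
open NumberField
open scoped nonZeroDivisors

noncomputable section

/-- A subset of `ℝ` is uniformly discrete if some `r > 0` separates distinct points. -/
def UniformlyDiscreteR (X : Set ℝ) : Prop :=
  ∃ r > 0, ∀ x ∈ X, ∀ y ∈ X, x ≠ y → r ≤ |x - y|

/-- A subset of `ℝ` is relatively dense if every interval of some fixed length meets it. -/
def RelativelyDenseR (X : Set ℝ) : Prop :=
  ∃ R > 0, ∀ v : ℝ, ∃ x ∈ X, |v - x| < R

/-- A Delaunay set in `ℝ`. -/
def IsDelaunayR (X : Set ℝ) : Prop := UniformlyDiscreteR X ∧ RelativelyDenseR X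

/-- The rank-1 quasicrystalline model ideal `𝔞_{𝔄,x} = {α ∈ 𝔄 : |α′| < θ^{-x}}`, as a subset
of `ℝ` via the embedding `ι`; `g` is the Galois conjugation. -/
def aQCF (K : Type*) [Field K] [NumberField K] (ι : K →+* ℝ) (g : K ≃+* K) (θ : ℝ)
    (𝔄 : FractionalIdeal (𝓞 K)⁰ K) (x : ℝ) : Set ℝ :=
  {t : ℝ | ∃ α : K, α ∈ 𝔄 ∧ ι α = t ∧ |ι (g α)| < θ ^ (-x)}

/-- The quasicrystalline sine `s_𝔞(z) = z·∏_{α∈𝔞, α>0} (1 - z²/α²)`. -/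
def sQC (𝔞 : Set ℝ) (z : ℂ) : ℂ :=
  z * ∏' a : {t : ℝ // t ∈ 𝔞 ∧ 0 < t}, (1 - z ^ 2 / ((a : ℝ) : ℂ) ^ 2)

/-- The quasicrystalline cosine `c_𝔞 = s_𝔞′`. -/
def cQC (𝔞 : Set ℝ) : ℂ → ℂ := deriv (sQC 𝔞)

/-- The set of real zeros of `c_𝔞`. -/
def bQC (𝔞 : Set ℝ) : Set ℝ := {b : ℝ | cQC 𝔞 (b : ℂ) = 0}

section Analysis

open Filter Topology

/-- The odd function `z ∏ (1 - bₙ z²)` attached to a sequence of coefficients `b`. -/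
def oddProd (b : ℕ → ℝ) (z : ℂ) : ℂ := z * ∏' n, (1 - (b n : ℂ) * z ^ 2)

/-- The logarithmic derivative of `oddProd b` at `t`, divided by `t`, as a function of `w = t²`. -/
def oddProdLogDeriv (b : ℕ → ℝ) (w : ℝ) : ℝ := 1 / w - ∑' n, 2 * b n / (1 - b n * w)

lemma hasProdLocallyUniformlyOn_one_sub_mul_sq {b : ℕ → ℝ} (hb : Summable b) (h0 : ∀ n, 0 ≤ b n) :
    HasProdLocallyUniformlyOn (fun n (z : ℂ) => 1 - (b n : ℂ) * z ^ 2)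
      (fun z => ∏' n, (1 - (b n : ℂ) * z ^ 2)) Set.univ := by
  apply hasProdLocallyUniformlyOn_of_forall_compact isOpen_univ
  intro S _ hS
  obtain ⟨M, hM⟩ := hS.isBounded.exists_norm_le
  have key := Summable.hasProdUniformlyOn_one_add (f := fun n (z : ℂ) => -((b n : ℂ) * z ^ 2)) hS
    (u := fun n => b n * M ^ 2) (hb.mul_right _) ?_ (fun i => by fun_prop)
  · simpa only [sub_eq_add_neg] using key
  · refine Eventually.of_forall fun n z hz => ?_
    have := hM z hz
    have := h0 n
    simp only [norm_neg, norm_mul, norm_pow, Complex.norm_real, Real.norm_eq_abs, abs_of_nonneg this]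
    gcongr

lemma summable_norm_mul_sq {b : ℕ → ℝ} (hb : Summable b) (h0 : ∀ n, 0 ≤ b n) (z : ℂ) :
    Summable fun n => ‖-((b n : ℂ) * z ^ 2)‖ := by
  simp only [norm_neg, norm_mul, Complex.norm_real, Real.norm_eq_abs, abs_of_nonneg (h0 _)]
  exact hb.mul_right _

lemma multipliable_one_sub_mul_sq {b : ℕ → ℝ} (hb : Summable b) (h0 : ∀ n, 0 ≤ b n) (z : ℂ) :
    Multipliable fun n => 1 - (b n : ℂ) * z ^ 2 := by
  simpa only [sub_eq_add_neg] using multipliable_one_add_of_summable (summable_norm_mul_sq hb h0 z)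

lemma differentiable_tprod_one_sub_mul_sq {b : ℕ → ℝ} (hb : Summable b) (h0 : ∀ n, 0 ≤ b n) :
    Differentiable ℂ fun z : ℂ => ∏' n, (1 - (b n : ℂ) * z ^ 2) := by
  rw [← differentiableOn_univ]
  exact (hasProdLocallyUniformlyOn_iff_tendstoLocallyUniformlyOn.mp
    (hasProdLocallyUniformlyOn_one_sub_mul_sq hb h0)).differentiableOn
    (Eventually.of_forall fun s => by fun_prop) isOpen_univ

lemma differentiable_oddProd {b : ℕ → ℝ} (hb : Summable b) (h0 : ∀ n, 0 ≤ b n) :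
    Differentiable ℂ (oddProd b) :=
  differentiable_id.mul (differentiable_tprod_one_sub_mul_sq hb h0)

lemma tprod_one_sub_mul_sq_ne_zero {b : ℕ → ℝ} (hb : Summable b) (h0 : ∀ n, 0 ≤ b n) {z : ℂ}
    (hz : ∀ n, (b n : ℂ) * z ^ 2 ≠ 1) : ∏' n, (1 - (b n : ℂ) * z ^ 2) ≠ 0 := by
  simp only [sub_eq_add_neg]
  refine tprod_one_add_ne_zero_of_summable (fun n h => hz n ?_) (summable_norm_mul_sq hb h0 z)
  linear_combination -h

lemma oddProd_ne_zero {b : ℕ → ℝ} (hb : Summable b) (h0 : ∀ n, 0 ≤ b n) {z : ℂ} (hz0 : z ≠ 0)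
    (hz : ∀ n, (b n : ℂ) * z ^ 2 ≠ 1) : oddProd b z ≠ 0 :=
  mul_ne_zero hz0 (tprod_one_sub_mul_sq_ne_zero hb h0 hz)

lemma oddProd_neg (b : ℕ → ℝ) (z : ℂ) : oddProd b (-z) = -oddProd b z := by
  simp [oddProd]

lemma deriv_oddProd_neg (b : ℕ → ℝ) (z : ℂ) :
    deriv (oddProd b) (-z) = deriv (oddProd b) z := by
  have h := deriv_comp_neg (oddProd b) z
  simp only [oddProd_neg, deriv.fun_neg] at h
  linear_combination h

lemma oddProd_ofReal_im {b : ℕ → ℝ} (hb : Summable b) (t : ℝ) :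
    (oddProd b t).im = 0 := by
  have hreal : Multipliable fun n => 1 - b n * t ^ 2 := by
    simp only [sub_eq_add_neg]
    exact Real.multipliable_one_add_of_summable (hb.mul_right _).neg
  have : oddProd b t = ((t * ∏' n, (1 - b n * t ^ 2) : ℝ) : ℂ) := by
    have := hreal.map_tprod Complex.ofRealHom Complex.continuous_ofReal
    simp only [Complex.ofRealHom_eq_coe] at this
    rw [oddProd, Complex.ofReal_mul, this]
    simp
  rw [this, Complex.ofReal_im]

lemma hasDerivAt_oddProd {b : ℕ → ℝ} (hb : Summable b) (h0 : ∀ n, 0 ≤ b n) (z : ℂ) :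
    HasDerivAt (oddProd b) (∏' n, (1 - (b n : ℂ) * z ^ 2)
      + z * deriv (fun z : ℂ => ∏' n, (1 - (b n : ℂ) * z ^ 2)) z) z := by
  have h := (hasDerivAt_id z).mul ((differentiable_tprod_one_sub_mul_sq hb h0) z).hasDerivAt
  simp only [id, one_mul] at h
  exact h

lemma deriv_oddProd_zero {b : ℕ → ℝ} (hb : Summable b) (h0 : ∀ n, 0 ≤ b n) :
    deriv (oddProd b) 0 = 1 := by
  simp [(hasDerivAt_oddProd hb h0 0).deriv]

/-- Boundedness of the denominators away from zero gives summability of the logarithmic derivative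
of the product. -/
lemma summable_oddProdLogDeriv {b : ℕ → ℝ} (hb : Summable b) (h0 : ∀ n, 0 ≤ b n) (w : ℝ) :
    Summable fun n => 2 * b n / (1 - b n * w) := by
  refine Summable.of_norm_bounded_eventually_nat (g := fun n => 4 * b n) (hb.mul_left 4) ?_
  have h : ∀ᶠ n in atTop, b n * w < 1 / 2 := by
    have := (hb.tendsto_atTop_zero.mul_const w)
    rw [zero_mul] at this
    exact this.eventually_lt_const (by norm_num)
  filter_upwards [h] with n hn
  have h2 : 0 < 1 - b n * w := by linarith
  have := h0 n
  rw [Real.norm_of_nonneg (by positivity), div_le_iff₀ h2]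
  nlinarith

lemma deriv_oddProd_eq {b : ℕ → ℝ} (hb : Summable b) (h0 : ∀ n, 0 ≤ b n) {t : ℝ} (ht0 : t ≠ 0)
    (ht : ∀ n, b n * t ^ 2 ≠ 1) :
    deriv (oddProd b) t = oddProd b t * ((t * oddProdLogDeriv b (t ^ 2) : ℝ) : ℂ) := by
  have htC : ∀ n, (b n : ℂ) * (t : ℂ) ^ 2 ≠ 1 := fun n h => ht n (by exact_mod_cast h)
  have ht0C : (t : ℂ) ≠ 0 := by exact_mod_cast ht0
  have hP := tprod_one_sub_mul_sq_ne_zero hb h0 htC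
  have hl : ∀ n, logDeriv (fun z : ℂ => 1 - (b n : ℂ) * z ^ 2) t
      = ((-(t * (2 * b n / (1 - b n * t ^ 2))) : ℝ) : ℂ) := by
    intro n
    have : HasDerivAt (fun z : ℂ => 1 - (b n : ℂ) * z ^ 2) (-((b n : ℂ) * (2 * (t : ℂ)))) t := by
      simpa using ((hasDerivAt_pow 2 (t : ℂ)).const_mul (b n : ℂ)).const_sub 1
    rw [logDeriv_apply, this.deriv]
    push_cast
    ring
  have hs := ((summable_oddProdLogDeriv hb h0 (t ^ 2)).mul_left t).neg
  have key := logDeriv_tprod_eq_tsum (f := fun n (z : ℂ) => 1 - (b n : ℂ) * z ^ 2) isOpen_univ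
    (Set.mem_univ (t : ℂ)) (fun n h => htC n (by linear_combination -h)) (fun n => by fun_prop)
    (by simp only [hl]; exact_mod_cast hs)
    (hasProdLocallyUniformlyOn_one_sub_mul_sq hb h0).multipliableLocallyUniformlyOn hP
  simp only [hl] at key
  rw [← Complex.ofReal_tsum, tsum_neg, tsum_mul_left] at key
  rw [logDeriv_apply, div_eq_iff hP] at key
  rw [(hasDerivAt_oddProd hb h0 t).deriv, key]
  simp only [oddProd, oddProdLogDeriv]
  generalize ∏' n, (1 - (b n : ℂ) * (t : ℂ) ^ 2) = P
  generalize ∑' n, 2 * b n / (1 - b n * t ^ 2) = S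
  push_cast
  field_simp
  ring

lemma deriv_oddProd_ne_zero_of_pole {b : ℕ → ℝ} (hb : Summable b) (h0 : ∀ n, 0 ≤ b n) {t : ℝ}
    {k : ℕ} (hk : b k * t ^ 2 = 1) (hinj : ∀ n, b n * t ^ 2 = 1 → n = k) :
    deriv (oddProd b) t ≠ 0 := by
  set c : ℕ → ℝ := fun n => if n = k then 0 else b n with hc
  have hc0 : ∀ n, 0 ≤ c n := fun n => by
    simp only [hc]; split_ifs <;> simp [h0]
  have hcs : Summable c := hb.of_nonneg_of_le hc0 fun n => by
    simp only [hc]; split_ifs <;> simp [h0]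
  have ht0 : t ≠ 0 := by rintro rfl; simp at hk
  have hfac : oddProd b = fun z => (1 - (b k : ℂ) * z ^ 2) * oddProd c z := by
    ext z
    have hupd : Function.update (fun n => 1 - (b n : ℂ) * z ^ 2) k 1
        = fun n => 1 - (c n : ℂ) * z ^ 2 := by
      ext n
      by_cases h : n = k
      · subst h; simp [hc]
      · simp [hc, h]
    have h1 := Multipliable.tprod_eq_mul_tprod_ite' (f := fun n => 1 - (b n : ℂ) * z ^ 2) k
      (by rw [hupd]; exact multipliable_one_sub_mul_sq hcs hc0 z)
    have h2 : ∀ n, (if n = k then 1 else 1 - (b n : ℂ) * z ^ 2) = 1 - (c n : ℂ) * z ^ 2 := by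
      intro n
      by_cases h : n = k <;> simp [hc, h]
    simp only [oddProd, h1, h2]
    ring
  have hne : oddProd c t ≠ 0 := by
    refine oddProd_ne_zero hcs hc0 (by exact_mod_cast ht0) fun n h => ?_
    have h' : c n * t ^ 2 = 1 := by exact_mod_cast h
    by_cases hn : n = k
    · simp [hc, hn] at h'
    · simp only [hc, hn, if_false] at h'
      exact hn (hinj n h')
  have h1 : HasDerivAt (fun z : ℂ => 1 - (b k : ℂ) * z ^ 2) (-((b k : ℂ) * (2 * (t : ℂ)))) t := by
    simpa using ((hasDerivAt_pow 2 (t : ℂ)).const_mul (b k : ℂ)).const_sub 1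
  have h2 := h1.fun_mul ((differentiable_oddProd hcs hc0) t).hasDerivAt
  have h3 : 1 - (b k : ℂ) * (t : ℂ) ^ 2 = 0 := by
    rw [sub_eq_zero]; exact_mod_cast hk.symm
  rw [hfac, h2.deriv, h3, zero_mul, add_zero]
  have hbk : (b k : ℂ) ≠ 0 := by
    rintro h
    rw [Complex.ofReal_eq_zero] at h
    simp [h] at hk
  have ht0C : (t : ℂ) ≠ 0 := by exact_mod_cast ht0
  exact mul_ne_zero (neg_ne_zero.mpr (mul_ne_zero hbk (mul_ne_zero two_ne_zero ht0C))) hne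

lemma deriv_oddProd_eq_zero_iff {b : ℕ → ℝ} (hb : Summable b) (h0 : ∀ n, 0 ≤ b n) {t : ℝ}
    (ht0 : t ≠ 0) (ht : ∀ n, b n * t ^ 2 ≠ 1) :
    deriv (oddProd b) t = 0 ↔ oddProdLogDeriv b (t ^ 2) = 0 := by
  have h : oddProd b t ≠ 0 :=
    oddProd_ne_zero hb h0 (by exact_mod_cast ht0) fun n h => ht n (by exact_mod_cast h)
  rw [deriv_oddProd_eq hb h0 ht0 ht, mul_eq_zero, or_iff_right h, Complex.ofReal_eq_zero,
    mul_eq_zero, or_iff_right ht0]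

lemma exists_oddProdLogDeriv_eq_zero {b : ℕ → ℝ} (hb : Summable b) (h0 : ∀ n, 0 ≤ b n) {p q : ℝ}
    (hp0 : 0 ≤ p) (hpq : p < q) (hp : oddProd b p = 0) (hq : oddProd b q = 0)
    (hno : ∀ t ∈ Set.Ioo p q, ∀ n, b n * t ^ 2 ≠ 1) :
    ∃ t ∈ Set.Ioo p q, oddProdLogDeriv b (t ^ 2) = 0 := by
  have hd : ∀ t : ℝ, HasDerivAt (fun t : ℝ => (oddProd b t).re) (deriv (oddProd b) t).re t :=
    fun t => ((differentiable_oddProd hb h0) t).hasDerivAt.real_of_complex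
  obtain ⟨t, ht, h⟩ := exists_hasDerivAt_eq_zero hpq
    (fun t _ => (hd t).continuousAt.continuousWithinAt) (by rw [hp, hq]) (fun t _ => hd t)
  refine ⟨t, ht, ?_⟩
  have ht0 : t ≠ 0 := (hp0.trans_lt ht.1).ne'
  have hne : oddProd b t ≠ 0 :=
    oddProd_ne_zero hb h0 (by exact_mod_cast ht0) fun n h => hno t ht n (by exact_mod_cast h)
  rw [deriv_oddProd_eq hb h0 ht0 (hno t ht), Complex.re_mul_ofReal] at h
  rcases mul_eq_zero.mp h with h | h
  · exact absurd (Complex.ext h (oddProd_ofReal_im hb t)) hne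
  · exact (mul_eq_zero.mp h).resolve_left ht0

lemma oddProdLogDeriv_lt {b : ℕ → ℝ} (hb : Summable b) (h0 : ∀ n, 0 ≤ b n) {w w' : ℝ}
    (hw : 0 < w) (hww : w < w') (hno : ∀ n, b n * w' < 1 ∨ 1 < b n * w) :
    oddProdLogDeriv b w' < oddProdLogDeriv b w := by
  have h1 : 1 / w' < 1 / w := one_div_lt_one_div_of_lt hw hww
  have h2 : ∑' n, 2 * b n / (1 - b n * w) ≤ ∑' n, 2 * b n / (1 - b n * w') := by
    refine (summable_oddProdLogDeriv hb h0 w).tsum_le_tsum (fun n => ?_)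
      (summable_oddProdLogDeriv hb h0 w')
    have hn := h0 n
    have hle : b n * w ≤ b n * w' := by gcongr
    rcases hno n with h | h
    · have : 0 < 1 - b n * w' := by linarith
      gcongr
    · rw [← neg_le_neg_iff, ← div_neg, ← div_neg]
      have : 0 < -(1 - b n * w) := by linarith
      gcongr
  unfold oddProdLogDeriv
  linarith

lemma oddProdLogDeriv_le_of_le {b c : ℕ → ℝ} (hb : Summable b) (h0 : ∀ n, 0 ≤ b n)
    (hc : Summable c) (hc0 : ∀ n, 0 ≤ c n) {w : ℝ}
    (hbc : ∀ n, b n = c n ∨ b n = 0 ∧ c n * w < 1) :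
    oddProdLogDeriv c w ≤ oddProdLogDeriv b w := by
  unfold oddProdLogDeriv
  gcongr 1 / w - ?_
  refine (summable_oddProdLogDeriv hb h0 w).tsum_le_tsum (fun n => ?_)
    (summable_oddProdLogDeriv hc hc0 w)
  rcases hbc n with h | ⟨h, h'⟩
  · rw [h]
  · rw [h]
    have := hc0 n
    have : 0 < 1 - c n * w := by linarith
    simp only [mul_zero, zero_div]
    positivity

lemma oddProd_eq_zero_of_pole {b : ℕ → ℝ} {t : ℝ} {k : ℕ} (hk : b k * t ^ 2 = 1) :
    oddProd b t = 0 := by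
  have : ∏' n, (1 - (b n : ℂ) * (t : ℂ) ^ 2) = 0 := by
    refine tprod_of_exists_eq_zero ⟨k, ?_⟩
    rw [sub_eq_zero]
    exact_mod_cast hk.symm
  rw [oddProd, this, mul_zero]

/-- `b` is a truncation of the sequence `1 / e (n + 1) ^ 2` that contains its first `k`
terms. -/
structure IsTruncation (e b : ℕ → ℝ) (k : ℕ) : Prop where
  eq_or : ∀ n, b n = 1 / e (n + 1) ^ 2 ∨ b n = 0
  eq_of_lt : ∀ n < k, b n = 1 / e (n + 1) ^ 2

section Gap

variable {e : ℕ → ℝ} (he : StrictMono e) (he0 : e 0 = 0)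
include he he0

lemma pos_of_strictMono (n : ℕ) : 0 < e (n + 1) := he0 ▸ he n.succ_pos

lemma nonneg_of_strictMono (n : ℕ) : 0 ≤ e n := he0 ▸ he.monotone n.zero_le

lemma pos_of_mem_gap {k : ℕ} {t : ℝ} (ht : t ∈ Set.Ioo (e k) (e (k + 1))) : 0 < t :=
  (nonneg_of_strictMono he he0 k).trans_lt ht.1

omit he he0 in
lemma IsTruncation.nonneg {b : ℕ → ℝ} {k : ℕ} (h : IsTruncation e b k) (n : ℕ) : 0 ≤ b n := by
  rcases h.eq_or n with h | h <;> rw [h]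
  positivity

omit he he0 in
lemma IsTruncation.summable {b : ℕ → ℝ} {k : ℕ} (h : IsTruncation e b k)
    (hs : Summable fun n => 1 / e (n + 1) ^ 2) : Summable b := by
  refine hs.of_nonneg_of_le (h.nonneg) fun n => ?_
  rcases h.eq_or n with h | h <;> rw [h]
  positivity

lemma IsTruncation.mul_sq_lt_one {b : ℕ → ℝ} {k m : ℕ} (h : IsTruncation e b k) {t : ℝ}
    (ht : t ∈ Set.Ioo (e m) (e (m + 1))) {n : ℕ} (hn : m ≤ n) : b n * t ^ 2 < 1 := by
  have ht0 := pos_of_mem_gap he he0 ht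
  have hpos := pos_of_strictMono he he0 n
  have hlt : t < e (n + 1) := ht.2.trans_le (he.monotone (by omega))
  rcases h.eq_or n with h | h <;> rw [h]
  · rw [one_div_mul_eq_div, div_lt_one (by positivity)]
    gcongr
  · simp

lemma IsTruncation.one_lt_mul_sq {b : ℕ → ℝ} {k m : ℕ} (h : IsTruncation e b k) {t : ℝ}
    (ht : t ∈ Set.Ioo (e m) (e (m + 1))) (hm : m ≤ k) {n : ℕ} (hn : n < m) :
    1 < b n * t ^ 2 := by
  have hpos := pos_of_strictMono he he0 n
  have hlt : e (n + 1) < t := (he.monotone (by omega)).trans_lt ht.1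
  rw [h.eq_of_lt n (by omega), one_div_mul_eq_div, one_lt_div (by positivity)]
  gcongr

lemma IsTruncation.mul_sq_ne_one {b : ℕ → ℝ} {k m : ℕ} (h : IsTruncation e b k) {t : ℝ}
    (ht : t ∈ Set.Ioo (e m) (e (m + 1))) (hm : m ≤ k) (n : ℕ) : b n * t ^ 2 ≠ 1 := by
  rcases le_or_gt m n with hn | hn
  · exact (h.mul_sq_lt_one he he0 ht hn).ne
  · exact (h.one_lt_mul_sq he he0 ht hm hn).ne'

lemma IsTruncation.oddProdLogDeriv_lt {b : ℕ → ℝ} {k m : ℕ} (h : IsTruncation e b k)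
    (hs : Summable fun n => 1 / e (n + 1) ^ 2) (hm : m ≤ k) {t u : ℝ}
    (ht : t ∈ Set.Ioo (e m) (e (m + 1))) (hu : u ∈ Set.Ioo (e m) (e (m + 1))) (htu : t < u) :
    oddProdLogDeriv b (u ^ 2) < oddProdLogDeriv b (t ^ 2) := by
  have ht0 := pos_of_mem_gap he he0 ht
  refine _root_.oddProdLogDeriv_lt (h.summable hs) (h.nonneg) (by positivity)
    (by gcongr) fun n => ?_
  rcases le_or_gt m n with hn | hn
  · exact Or.inl (h.mul_sq_lt_one he he0 hu hn)
  · exact Or.inr (h.one_lt_mul_sq he he0 ht hm hn)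

lemma IsTruncation.oddProd_eq_zero {b : ℕ → ℝ} {k m : ℕ} (h : IsTruncation e b k) (hm : m ≤ k) :
    oddProd b (e m) = 0 := by
  rcases m with _ | m
  · simp [oddProd, he0]
  · refine oddProd_eq_zero_of_pole (k := m) ?_
    have hpos := pos_of_strictMono he he0 m
    rw [h.eq_of_lt m (by omega), one_div_mul_cancel (by positivity)]

lemma IsTruncation.exists_zero {b : ℕ → ℝ} {k m : ℕ} (h : IsTruncation e b k)
    (hs : Summable fun n => 1 / e (n + 1) ^ 2) (hm : m < k) :
    ∃ t ∈ Set.Ioo (e m) (e (m + 1)), oddProdLogDeriv b (t ^ 2) = 0 :=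
  exists_oddProdLogDeriv_eq_zero (h.summable hs) (h.nonneg)
    (nonneg_of_strictMono he he0 m) (he m.lt_succ_self) (h.oddProd_eq_zero he he0 hm.le)
    (h.oddProd_eq_zero he he0 hm) fun _ ht n => h.mul_sq_ne_one he he0 ht hm.le n

lemma IsTruncation.deriv_eq_zero_iff {b : ℕ → ℝ} {k m : ℕ} (h : IsTruncation e b k)
    (hs : Summable fun n => 1 / e (n + 1) ^ 2) (hm : m ≤ k) {t : ℝ}
    (ht : t ∈ Set.Ioo (e m) (e (m + 1))) :
    deriv (oddProd b) t = 0 ↔ oddProdLogDeriv b (t ^ 2) = 0 :=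
  deriv_oddProd_eq_zero_iff (h.summable hs) (h.nonneg)
    (pos_of_mem_gap he he0 ht).ne' (h.mul_sq_ne_one he he0 ht hm)

omit he he0 in
lemma isTruncation_full (k : ℕ) : IsTruncation e (fun n => 1 / e (n + 1) ^ 2) k :=
  ⟨fun _ => Or.inl rfl, fun _ _ => rfl⟩

omit he he0 in
lemma isTruncation_trunc (k : ℕ) :
    IsTruncation e (fun n => if n < k then 1 / e (n + 1) ^ 2 else 0) k :=
  ⟨fun n => by split_ifs <;> simp, fun n hn => by simp [hn]⟩

/-- The zeros of the logarithmic derivative in the gaps `(e n, e (n + 1))`. -/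
lemma exists_zero_seq (hs : Summable fun n => 1 / e (n + 1) ^ 2) :
    ∃ β : ℕ → ℝ, (∀ n, β n ∈ Set.Ioo (e n) (e (n + 1))) ∧
      (∀ n, oddProdLogDeriv (fun n => 1 / e (n + 1) ^ 2) (β n ^ 2) = 0) := by
  choose β h1 h2 using fun m => (isTruncation_full (e := e) (m + 1)).exists_zero he he0 hs
    (Nat.lt_succ_self m)
  exact ⟨β, h1, h2⟩

lemma deriv_oddProd_ne_zero_of_seq (hs : Summable fun n => 1 / e (n + 1) ^ 2) (m : ℕ) :
    deriv (oddProd fun n => 1 / e (n + 1) ^ 2) (e m) ≠ 0 := by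
  have hfull := isTruncation_full (e := e) 0
  rcases m with _ | m
  · rw [he0, Complex.ofReal_zero, deriv_oddProd_zero hs (hfull.nonneg)]
    exact one_ne_zero
  · have hpos := fun n => pos_of_strictMono he he0 n
    refine deriv_oddProd_ne_zero_of_pole hs (hfull.nonneg) (k := m)
      (one_div_mul_cancel (pow_pos (hpos m) 2).ne') fun n hn => ?_
    have h2 := hpos n
    rw [one_div_mul_eq_div, div_eq_one_iff_eq (by positivity)] at hn
    have := he.injective ((pow_left_inj₀ (hpos m).le (hpos n).le two_ne_zero).mp hn)
    omega

end Gap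

section Factorization

open Polynomial

lemma coeff_prod_linear_eq_zero (c : ℕ → ℂ) {N m : ℕ} (hm : N < m) :
    (∏ n ∈ Finset.range N, (1 - C (c n) * X)).coeff m = 0 := by
  refine coeff_eq_zero_of_natDegree_lt (lt_of_le_of_lt ?_ hm)
  refine (natDegree_prod_le _ _).trans ?_
  calc ∑ n ∈ Finset.range N, (1 - C (c n) * X).natDegree ≤ ∑ n ∈ Finset.range N, 1 := by
        refine Finset.sum_le_sum fun n _ => ?_
        compute_degree
    _ = N := by simp

lemma deriv_mul_prod_eq_prod_of_zeros {N : ℕ} (c : ℕ → ℂ) {γ : ℕ → ℂ}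
    (h0 : ∀ n < N, γ n ≠ 0) (hγ : Set.InjOn (fun n => γ n ^ 2) (Set.Iio N))
    (hz : ∀ n < N, deriv (fun z : ℂ => z * ∏ m ∈ Finset.range N, (1 - c m * z ^ 2)) (γ n) = 0)
    (z : ℂ) :
    deriv (fun z : ℂ => z * ∏ m ∈ Finset.range N, (1 - c m * z ^ 2)) z
      = ∏ n ∈ Finset.range N, (1 - z ^ 2 / γ n ^ 2) := by
  set p : ℂ[X] := ∏ n ∈ Finset.range N, (1 - C (c n) * X) with hp
  set Q : ℂ[X] := ∏ n ∈ Finset.range N, (1 - C (1 / γ n ^ 2) * X) with hQ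
  have hfun : (fun z : ℂ => z * ∏ m ∈ Finset.range N, (1 - c m * z ^ 2))
      = fun z => z * p.eval (z ^ 2) := by
    ext z
    simp [hp, eval_prod]
  have hderiv : ∀ z : ℂ, deriv (fun z : ℂ => z * ∏ m ∈ Finset.range N, (1 - c m * z ^ 2)) z
      = (p + 2 * (X * derivative p)).eval (z ^ 2) := by
    intro z
    have h1 := (hasDerivAt_id z).fun_mul ((p.hasDerivAt (z ^ 2)).comp z (hasDerivAt_pow 2 z))
    have h2 := h1.deriv
    simp only [id, Function.comp_apply] at h2
    rw [hfun, h2]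
    simp
    ring
  have hpoly : p + 2 * (X * derivative p) = Q := by
    refine eq_of_degrees_lt_of_eval_index_eq (Finset.range (N + 1))
      (v := fun n => Nat.casesOn n 0 fun k => γ k ^ 2) ?_ ?_ ?_ ?_
    · intro i hi j hj hij
      simp only [Finset.coe_range, Set.mem_Iio] at hi hj
      rcases i with _ | i <;> rcases j with _ | j
      · rfl
      · exact absurd hij.symm (pow_ne_zero 2 (h0 j (by omega)))
      · exact absurd hij (pow_ne_zero 2 (h0 i (by omega)))
      · rw [hγ (Set.mem_Iio.mpr (by omega)) (Set.mem_Iio.mpr (by omega)) hij]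
    · rw [Finset.card_range, degree_lt_iff_coeff_zero]
      intro m hm
      rcases m with _ | m
      · omega
      · have h := coeff_prod_linear_eq_zero c (N := N) (m := m + 1) (by omega)
        rw [← hp] at h
        rw [coeff_add, coeff_ofNat_mul, coeff_X_mul, coeff_derivative, h]
        simp
    · rw [Finset.card_range, degree_lt_iff_coeff_zero]
      intro m hm
      exact coeff_prod_linear_eq_zero _ (by omega)
    · intro i hi
      rw [Finset.mem_range] at hi
      rcases i with _ | i
      · simp [hp, hQ, eval_prod]
      · have h := h0 i (by omega)
        change eval (γ i ^ 2) _ = eval (γ i ^ 2) _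
        rw [← hderiv, hz i (by omega), hQ, eval_prod]
        refine (Finset.prod_eq_zero (Finset.mem_range.mpr (show i < N by omega)) ?_).symm
        simp [h]
  rw [hderiv, hpoly, hQ, eval_prod]
  refine Finset.prod_congr rfl fun n _ => ?_
  simp
  ring

end Factorization

section Limit

variable {e : ℕ → ℝ} (he : StrictMono e) (he0 : e 0 = 0)

lemma oddProd_trunc (e : ℕ → ℝ) (N : ℕ) :
    oddProd (fun n => if n < N then 1 / e (n + 1) ^ 2 else 0)
      = fun z => z * ∏ n ∈ Finset.range N, (1 - ((1 / e (n + 1) ^ 2 : ℝ) : ℂ) * z ^ 2) := by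
  ext z
  rw [oddProd, tprod_eq_prod (s := Finset.range N)]
  · congr 1
    refine Finset.prod_congr rfl fun n hn => ?_
    rw [if_pos (Finset.mem_range.mp hn)]
  · intro n hn
    rw [if_neg (by simpa using hn)]
    simp

lemma tendsto_deriv_oddProd_trunc (hs : Summable fun n => 1 / e (n + 1) ^ 2) (z : ℂ) :
    Tendsto (fun N => deriv (oddProd fun n => if n < N then 1 / e (n + 1) ^ 2 else 0) z) atTop
      (𝓝 (deriv (oddProd fun n => 1 / e (n + 1) ^ 2) z)) := by
  have h0 := (isTruncation_full (e := e) 0).nonneg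
  have h1 := (hasProdLocallyUniformlyOn_one_sub_mul_sq hs h0).tendstoLocallyUniformlyOn_finsetRange
  have h2 := h1.deriv (Eventually.of_forall fun s => by fun_prop) isOpen_univ
  have h3 := h1.tendsto_at (Set.mem_univ z)
  have h4 := h2.tendsto_at (Set.mem_univ z)
  rw [(hasDerivAt_oddProd hs h0 z).deriv]
  refine (h3.add (h4.const_mul z)).congr fun N => ?_
  rw [oddProd_trunc]
  have hd : Differentiable ℂ
    fun z : ℂ => ∏ n ∈ Finset.range N, (1 - ((1 / e (n + 1) ^ 2 : ℝ) : ℂ) * z ^ 2) := by fun_prop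
  have h5 := ((hasDerivAt_id z).fun_mul (hd z).hasDerivAt).deriv
  simp only [id, one_mul] at h5
  rw [h5]
  rfl

lemma tendsto_oddProdLogDeriv_trunc (hs : Summable fun n => 1 / e (n + 1) ^ 2) (w : ℝ) :
    Tendsto (fun N => oddProdLogDeriv (fun n => if n < N then 1 / e (n + 1) ^ 2 else 0) w) atTop
      (𝓝 (oddProdLogDeriv (fun n => 1 / e (n + 1) ^ 2) w)) := by
  have h0 := (isTruncation_full (e := e) 0).nonneg
  unfold oddProdLogDeriv
  refine ((summable_oddProdLogDeriv hs h0 w).hasSum.tendsto_sum_nat.congr fun N => ?_).const_sub _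
  rw [tsum_eq_sum (s := Finset.range N)]
  · refine Finset.sum_congr rfl fun n hn => ?_
    simp only [if_pos (Finset.mem_range.mp hn)]
  · intro n hn
    simp [show ¬ n < N by simpa using hn]

include he he0 in
theorem deriv_oddProd_eq_tprod (hs : Summable fun n => 1 / e (n + 1) ^ 2) {β : ℕ → ℝ}
    (hβ : ∀ n, β n ∈ Set.Ioo (e n) (e (n + 1)))
    (hβ0 : ∀ n, oddProdLogDeriv (fun n => 1 / e (n + 1) ^ 2) (β n ^ 2) = 0) (z : ℂ) :
    deriv (oddProd fun n => 1 / e (n + 1) ^ 2) z = ∏' n, (1 - z ^ 2 / (β n : ℂ) ^ 2) := by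
  have hfull := isTruncation_full (e := e)
  have htr := isTruncation_trunc (e := e)
  have hex : ∀ N n, ∃ t, n < N → t ∈ Set.Ioo (e n) (e (n + 1)) ∧
      oddProdLogDeriv (fun n => if n < N then 1 / e (n + 1) ^ 2 else 0) (t ^ 2) = 0 := by
    intro N n
    by_cases hn : n < N
    · obtain ⟨t, h1, h2⟩ := (htr N).exists_zero he he0 hs hn
      exact ⟨t, fun _ => ⟨h1, h2⟩⟩
    · exact ⟨0, fun h => absurd h hn⟩
  choose γ hγ using hex
  have hβpos : ∀ n, 0 < β n := fun n => pos_of_mem_gap he he0 (hβ n)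
  have hle : ∀ N n, n < N → β n ≤ γ N n := by
    intro N n hn
    obtain ⟨h1, h2⟩ := hγ N n hn
    by_contra! hlt
    have h3 := (hfull n).oddProdLogDeriv_lt he he0 hs le_rfl h1 (hβ n) hlt
    have h4 := oddProdLogDeriv_le_of_le ((htr N).summable hs) (htr N).nonneg hs (hfull 0).nonneg
      (w := γ N n ^ 2) fun k => by
        by_cases hk : k < N
        · exact Or.inl (if_pos hk)
        · exact Or.inr ⟨if_neg hk, (hfull 0).mul_sq_lt_one he he0 h1 (by omega)⟩
    rw [hβ0] at h3
    rw [h2] at h4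
    linarith
  have hlim : ∀ n, Tendsto (fun N => γ N n) atTop (𝓝 (β n)) := by
    intro n
    rw [tendsto_order]
    refine ⟨fun u hu => ?_, fun u hu => ?_⟩
    · filter_upwards [eventually_gt_atTop n] with N hN using hu.trans_le (hle N n hN)
    · obtain ⟨t, ht1, ht2⟩ := exists_between (lt_min hu (hβ n).2)
      have ht : t ∈ Set.Ioo (e n) (e (n + 1)) :=
        ⟨(hβ n).1.trans ht1, ht2.trans_le (min_le_right _ _)⟩
      have hneg := (hfull n).oddProdLogDeriv_lt he he0 hs le_rfl (hβ n) ht ht1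
      rw [hβ0] at hneg
      filter_upwards [eventually_gt_atTop n,
        (tendsto_oddProdLogDeriv_trunc hs (t ^ 2)).eventually_lt_const hneg] with N hN hN'
      obtain ⟨h1, h2⟩ := hγ N n hN
      have hlt : γ N n < t := by
        by_contra! hge
        rcases hge.eq_or_lt with h | h
        · rw [h, h2] at hN'
          exact lt_irrefl _ hN'
        · have := (htr N).oddProdLogDeriv_lt he he0 hs hN.le ht h1 h
          rw [h2] at this
          linarith
      exact hlt.trans (ht2.trans_le (min_le_left _ _))
  have hfac : ∀ N, deriv (oddProd fun n => if n < N then 1 / e (n + 1) ^ 2 else 0) z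
      = ∏' n, (1 + if n < N then -(z ^ 2 / (γ N n : ℂ) ^ 2) else 0) := by
    intro N
    have hpos : ∀ n < N, 0 < γ N n := fun n hn => pos_of_mem_gap he he0 (hγ N n hn).1
    have hlt : ∀ i j, i < j → j < N → γ N i < γ N j := fun i j hij hj =>
      (hγ N i (hij.trans hj)).1.2.trans ((he.monotone hij).trans_lt (hγ N j hj).1.1)
    rw [oddProd_trunc, deriv_mul_prod_eq_prod_of_zeros (γ := fun n => (γ N n : ℂ)),
      tprod_eq_prod (s := Finset.range N)]
    · refine Finset.prod_congr rfl fun n hn => ?_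
      rw [if_pos (Finset.mem_range.mp hn), sub_eq_add_neg]
    · intro n hn
      rw [if_neg (by simpa using hn), add_zero]
    · intro n hn
      exact_mod_cast (hpos n hn).ne'
    · intro i hi j hj hij
      rw [Set.mem_Iio] at hi hj
      have hij' : γ N i ^ 2 = γ N j ^ 2 := by
        have h : (γ N i : ℂ) ^ 2 = (γ N j : ℂ) ^ 2 := hij
        exact_mod_cast h
      have hij'' := (pow_left_inj₀ (hpos i hi).le (hpos j hj).le two_ne_zero).mp hij'
      rcases lt_trichotomy i j with h | h | h
      · exact absurd hij'' (hlt i j h hj).ne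
      · exact h
      · exact absurd hij'' (hlt j i h hi).ne'
    · intro n hn
      rw [← oddProd_trunc, (htr N).deriv_eq_zero_iff he he0 hs hn.le (hγ N n hn).1]
      exact (hγ N n hn).2
  have hbound : Summable fun n => ‖z‖ ^ 2 * (1 / β n ^ 2) := by
    refine Summable.mul_left _ ((summable_nat_add_iff 1).mp ?_)
    refine hs.of_nonneg_of_le (fun n => by positivity) fun n => ?_
    have := pos_of_strictMono he he0 n
    have := (hβ (n + 1)).1.le
    gcongr
  have hconv := tendsto_tprod_one_add_of_dominated_convergence (𝓕 := atTop)
    (f := fun N n => if n < N then -(z ^ 2 / (γ N n : ℂ) ^ 2) else 0)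
    (g := fun n => -(z ^ 2 / (β n : ℂ) ^ 2)) hbound ?_ ?_
  · refine tendsto_nhds_unique (tendsto_deriv_oddProd_trunc hs z) ?_
    simp only [hfac, sub_eq_add_neg]
    exact hconv
  · intro n
    have hne : (β n : ℂ) ^ 2 ≠ 0 := pow_ne_zero 2 (by exact_mod_cast (hβpos n).ne')
    have h1 : Tendsto (fun N => -(z ^ 2 / (γ N n : ℂ) ^ 2)) atTop
        (𝓝 (-(z ^ 2 / (β n : ℂ) ^ 2))) :=
      (tendsto_const_nhds.div
        (((Complex.continuous_ofReal.tendsto _).comp (hlim n)).pow 2) hne).neg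
    refine h1.congr' ?_
    filter_upwards [eventually_gt_atTop n] with N hN
    rw [if_pos hN]
  · refine Eventually.of_forall fun N n => ?_
    have := hβpos n
    split_ifs with hn
    · have := hle N n hn
      simp only [norm_neg, norm_div, norm_pow, Complex.norm_real, Real.norm_eq_abs, sq_abs]
      rw [div_eq_mul_one_div]
      gcongr
    · rw [norm_zero]
      positivity

end Limit

section Delaunay

lemma mul_le_sub_of_step {e : ℕ → ℝ} {r : ℝ} (hr : ∀ n, r ≤ e (n + 1) - e n) {m n : ℕ}
    (hmn : m ≤ n) : r * ((n : ℝ) - m) ≤ e n - e m := by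
  induction n, hmn using Nat.le_induction with
  | base => simp
  | succ n _ ih =>
    have := hr n
    push_cast
    linarith

lemma mul_abs_le_abs_sub_of_step {e : ℕ → ℝ} {r : ℝ} (hr : ∀ n, r ≤ e (n + 1) - e n) (m n : ℕ) :
    r * |(n : ℝ) - m| ≤ |e n - e m| := by
  rcases le_total m n with h | h
  · have h' : (0 : ℝ) ≤ n - m := by rw [sub_nonneg]; exact_mod_cast h
    rw [abs_of_nonneg h']
    exact (mul_le_sub_of_step hr h).trans (le_abs_self _)
  · have h' : (0 : ℝ) ≤ m - n := by rw [sub_nonneg]; exact_mod_cast h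
    rw [abs_sub_comm, abs_of_nonneg h', abs_sub_comm]
    exact (mul_le_sub_of_step hr h).trans (le_abs_self _)

section Separated

variable {e : ℕ → ℝ} {r : ℝ} (hr0 : 0 < r) (hr : ∀ n, r ≤ e (n + 1) - e n)
include hr0 hr

lemma strictMono_of_step : StrictMono e :=
  strictMono_nat_of_lt_succ fun n => by linarith [hr n]

lemma summable_one_div_sq_of_step (he0 : e 0 = 0) : Summable fun n => 1 / e (n + 1) ^ 2 := by
  have h := (summable_nat_add_iff 1).mpr
    (Real.summable_one_div_nat_pow.mpr (one_lt_two : (1 : ℕ) < 2))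
  refine (h.mul_left (1 / r ^ 2)).of_nonneg_of_le (fun n => by positivity) fun n => ?_
  have h1 := mul_le_sub_of_step hr (Nat.zero_le (n + 1))
  rw [he0, Nat.cast_zero, sub_zero, sub_zero] at h1
  rw [div_mul_div_comm, one_mul, ← mul_pow]
  gcongr

lemma exists_mem_Ico_of_step (he0 : e 0 = 0) {t : ℝ} (ht : 0 ≤ t) :
    ∃ n, t ∈ Set.Ico (e n) (e (n + 1)) := by
  have htop : Tendsto e atTop atTop := by
    refine tendsto_atTop_mono (f := fun n : ℕ => r * (n : ℝ)) (fun n => ?_)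
      (tendsto_natCast_atTop_atTop.const_mul_atTop hr0)
    have h1 := mul_le_sub_of_step hr (Nat.zero_le n)
    simpa [he0] using h1
  have hex : ∃ n, t < e n := (htop.eventually_gt_atTop t).exists
  classical
  have hpos : Nat.find hex ≠ 0 := fun h => by
    have := Nat.find_spec hex
    rw [h, he0] at this
    linarith
  obtain ⟨k, hk⟩ := Nat.exists_eq_succ_of_ne_zero hpos
  refine ⟨k, not_lt.mp (Nat.find_min hex (by omega)), ?_⟩
  have := Nat.find_spec hex
  rwa [hk] at this

/-- If consecutive points of `e` are `r`-separated, then so are the zeros of the derivative in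
adjacent gaps, with a constant depending only on `r`. -/
lemma sub_ge_of_consecutive_zeros (he0 : e 0 = 0) {m : ℕ} {t u : ℝ}
    (ht : t ∈ Set.Ioo (e m) (e (m + 1))) (hu : u ∈ Set.Ioo (e (m + 1)) (e (m + 2)))
    (ht0 : oddProdLogDeriv (fun n => 1 / e (n + 1) ^ 2) (t ^ 2) = 0)
    (hu0 : oddProdLogDeriv (fun n => 1 / e (n + 1) ^ 2) (u ^ 2) = 0) :
    r / (3 * (1 + 4 * ∑' k : ℤ, 1 / (k : ℝ) ^ 2)) ≤ u - t := by
  have he := strictMono_of_step hr0 hr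
  have hs := summable_one_div_sq_of_step hr0 hr he0
  have hfull := isTruncation_full (e := e)
  have hb0 := (hfull 0).nonneg
  have hZs : Summable fun k : ℤ => 1 / (k : ℝ) ^ 2 := Real.summable_one_div_int_pow.mpr one_lt_two
  set Z := ∑' k : ℤ, 1 / (k : ℝ) ^ 2 with hZ
  have hZ0 : 0 ≤ Z := tsum_nonneg fun k => by positivity
  have htpos : 0 < t := pos_of_mem_gap he he0 ht
  have hupos : 0 < u := pos_of_mem_gap he he0 hu
  have hepos := fun n => pos_of_strictMono he he0 n
  set a := e (m + 1) with ha
  have hapos : 0 < a := hepos m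
  have hra : r ≤ a := by
    have := hr m
    have := nonneg_of_strictMono he he0 m
    linarith
  by_cases hd : r / 2 ≤ u - t
  · refine le_trans ?_ hd
    gcongr
    linarith
  push Not at hd
  have htu : 0 < u - t := by linarith [ht.2, hu.1]
  have hta : a / 2 ≤ t := by linarith [hu.1]
  have hua : u ≤ 2 * a := by linarith [ht.2]
  set f : ℕ → ℝ := fun n => 2 / ((e (n + 1) ^ 2 - t ^ 2) * (e (n + 1) ^ 2 - u ^ 2)) with hf
  have htne : ∀ n, e (n + 1) ^ 2 - t ^ 2 ≠ 0 := fun n h => by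
    refine (hfull m).mul_sq_ne_one he he0 ht le_rfl n ?_
    have := (hepos n).ne'
    field_simp
    linarith
  have hune : ∀ n, e (n + 1) ^ 2 - u ^ 2 ≠ 0 := fun n h => by
    refine (hfull (m + 1)).mul_sq_ne_one he he0 hu le_rfl n ?_
    have := (hepos n).ne'
    field_simp
    linarith
  have hut2 : 0 < u ^ 2 - t ^ 2 := by nlinarith
  have hfsum : HasSum f (-(1 / (t ^ 2 * u ^ 2))) := by
    have h1 := (summable_oddProdLogDeriv hs hb0 (u ^ 2)).hasSum.sub
      (summable_oddProdLogDeriv hs hb0 (t ^ 2)).hasSum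
    have ht1 : ∑' n, 2 * (1 / e (n + 1) ^ 2) / (1 - 1 / e (n + 1) ^ 2 * t ^ 2) = 1 / t ^ 2 := by
      unfold oddProdLogDeriv at ht0
      linarith
    have hu1 : ∑' n, 2 * (1 / e (n + 1) ^ 2) / (1 - 1 / e (n + 1) ^ 2 * u ^ 2) = 1 / u ^ 2 := by
      unfold oddProdLogDeriv at hu0
      linarith
    rw [ht1, hu1] at h1
    have h2 := h1.mul_left (1 / (u ^ 2 - t ^ 2))
    have hterm : ∀ n w, e (n + 1) ^ 2 - w ≠ 0 →
        2 * (1 / e (n + 1) ^ 2) / (1 - 1 / e (n + 1) ^ 2 * w) = 2 / (e (n + 1) ^ 2 - w) := by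
      intro n w hw
      have hen := (hepos n).ne'
      rw [show 1 - 1 / e (n + 1) ^ 2 * w = (e (n + 1) ^ 2 - w) * (1 / e (n + 1) ^ 2) by
        field_simp, mul_div_mul_right _ _ (by positivity)]
    have hfe : f = fun n => 1 / (u ^ 2 - t ^ 2) *
        (2 * (1 / e (n + 1) ^ 2) / (1 - 1 / e (n + 1) ^ 2 * u ^ 2)
          - 2 * (1 / e (n + 1) ^ 2) / (1 - 1 / e (n + 1) ^ 2 * t ^ 2)) := by
      ext n
      rw [hterm n _ (hune n), hterm n _ (htne n)]
      have h3 := htne n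
      have h4 := hune n
      have h5 := hut2.ne'
      simp only [hf]
      field_simp
      ring
    have hv : -(1 / (t ^ 2 * u ^ 2)) = 1 / (u ^ 2 - t ^ 2) * (1 / u ^ 2 - 1 / t ^ 2) := by
      have h5 := hut2.ne'
      field_simp
      ring
    rw [hfe, hv]
    exact h2
  have hsplit := hfsum.summable.tsum_eq_add_tsum_ite m
  rw [hfsum.tsum_eq] at hsplit
  have hgs : Summable fun n : ℕ => 16 / (a ^ 2 * r ^ 2) * (1 / (((n : ℤ) - m : ℤ) : ℝ) ^ 2) :=
    (hZs.comp_injective (i := fun n : ℕ => (n : ℤ) - m) fun i j h => by simpa using h).mul_left _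
  have hrest : ∑' n, (if n = m then 0 else f n) ≤ 16 / (a ^ 2 * r ^ 2) * Z := by
    have h1 : ∑' n : ℕ, 16 / (a ^ 2 * r ^ 2) * (1 / (((n : ℤ) - m : ℤ) : ℝ) ^ 2)
        ≤ 16 / (a ^ 2 * r ^ 2) * Z := by
      rw [tsum_mul_left]
      gcongr
      exact tsum_comp_le_tsum_of_inj hZs (fun k => by positivity)
        (i := fun n : ℕ => (n : ℤ) - m) fun i j h => by simpa using h
    refine le_trans (Summable.tsum_le_tsum (fun n => ?_) ?_ hgs) h1
    · split_ifs with hn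
      · positivity
      · push_cast
        have hk : 1 ≤ |(n : ℝ) - m| := by
          have : (1 : ℤ) ≤ |(n : ℤ) - m| := Int.one_le_abs (sub_ne_zero.mpr (by exact_mod_cast hn))
          exact_mod_cast this
        have hsep : r * |(n : ℝ) - m| ≤ |e (n + 1) - a| := by
          have := mul_abs_le_abs_sub_of_step hr (m + 1) (n + 1)
          push_cast at this
          simpa using this
        have hrk : r ≤ r * |(n : ℝ) - m| := le_mul_of_one_le_right hr0.le hk
        have ht' : r * |(n : ℝ) - m| / 2 ≤ |e (n + 1) - t| := by
          have h2 := abs_sub_le (e (n + 1)) t a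
          have h3 : |t - a| ≤ r / 2 := by
            rw [abs_le]; constructor <;> linarith [ht.2, hu.1]
          linarith
        have hu' : r * |(n : ℝ) - m| / 2 ≤ |e (n + 1) - u| := by
          have h2 := abs_sub_le (e (n + 1)) u a
          have h3 : |u - a| ≤ r / 2 := by
            rw [abs_le]; constructor <;> linarith [ht.2, hu.1]
          linarith
        have hen := hepos n
        have hden : a ^ 2 * r ^ 2 * ((n : ℝ) - m) ^ 2 / 8
            ≤ |(e (n + 1) ^ 2 - t ^ 2) * (e (n + 1) ^ 2 - u ^ 2)| := by
          have h2 : a / 2 ≤ e (n + 1) + t := by linarith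
          have h3 : a ≤ e (n + 1) + u := by linarith [hu.1]
          calc a ^ 2 * r ^ 2 * ((n : ℝ) - m) ^ 2 / 8
              = ((r * |(n : ℝ) - m| / 2) * (a / 2)) * ((r * |(n : ℝ) - m| / 2) * a) := by
                rw [← sq_abs ((n : ℝ) - m)]; ring
            _ ≤ (|e (n + 1) - t| * (e (n + 1) + t)) * (|e (n + 1) - u| * (e (n + 1) + u)) := by
                gcongr
            _ = _ := by
                rw [abs_mul, sq_sub_sq, sq_sub_sq, abs_mul, abs_mul,
                  abs_of_pos (show 0 < e (n + 1) + t by linarith),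
                  abs_of_pos (show 0 < e (n + 1) + u by linarith)]
                ring
        have hkpos : 0 < ((n : ℝ) - m) ^ 2 := by
          rw [← sq_abs]; positivity
        calc f n ≤ |f n| := le_abs_self _
          _ = 2 / |(e (n + 1) ^ 2 - t ^ 2) * (e (n + 1) ^ 2 - u ^ 2)| := by
              rw [hf, abs_div, abs_two]
          _ ≤ 2 / (a ^ 2 * r ^ 2 * ((n : ℝ) - m) ^ 2 / 8) := by gcongr
          _ = 16 / (a ^ 2 * r ^ 2) * (1 / ((n : ℝ) - m) ^ 2) := by field_simp; norm_num
    · refine hfsum.summable.abs.of_norm_bounded fun n => ?_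
      split_ifs
      · simp
      · exact le_rfl
  have hfm : 4 / (3 * a ^ 2 * (u - t) ^ 2) ≤ -f m := by
    have h1 : (a - t) * (u - a) ≤ (u - t) ^ 2 / 4 := by nlinarith [sq_nonneg ((a - t) - (u - a))]
    have h2 : (a + t) * (u + a) ≤ 6 * a ^ 2 := by nlinarith [ht.2]
    have h3 : 0 < (a - t) * (u - a) := mul_pos (by linarith [ht.2]) (by linarith [hu.1])
    have h4 : 0 < (a + t) * (u + a) := by positivity
    have h5 : -f m = 2 / (((a - t) * (u - a)) * ((a + t) * (u + a))) := by
      simp only [hf]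
      rw [← div_neg]
      congr 1
      ring
    rw [h5]
    calc 4 / (3 * a ^ 2 * (u - t) ^ 2) = 2 / ((u - t) ^ 2 / 4 * (6 * a ^ 2)) := by
          field_simp; norm_num
      _ ≤ _ := by gcongr
  have hfirst : 1 / (t ^ 2 * u ^ 2) ≤ 4 / (a ^ 2 * r ^ 2) := by
    calc 1 / (t ^ 2 * u ^ 2) ≤ 1 / ((a / 2) ^ 2 * r ^ 2) := by
          gcongr
          linarith [hu.1]
      _ = _ := by field_simp; norm_num
  have hmain : 4 / (3 * a ^ 2 * (u - t) ^ 2) ≤ 4 / (a ^ 2 * r ^ 2) * (1 + 4 * Z) := by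
    have : 16 / (a ^ 2 * r ^ 2) * Z = 4 / (a ^ 2 * r ^ 2) * (4 * Z) := by ring
    linarith
  have hsq : r ^ 2 ≤ 3 * (1 + 4 * Z) * (u - t) ^ 2 := by
    rw [div_mul_eq_mul_div, div_le_div_iff₀ (by positivity) (by positivity)] at hmain
    have : 0 < 4 * a ^ 2 := by positivity
    nlinarith
  rw [div_le_iff₀ (by positivity)]
  refine (pow_le_pow_iff_left₀ hr0.le (by positivity) two_ne_zero).mp (hsq.trans ?_)
  rw [mul_pow, mul_comm]
  gcongr
  nlinarith

end Separated

end Delaunay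

section Assembly

/-- An injective enumeration of the positive part of a set, as an equivalence. -/
def equivPosPart {X : Set ℝ} {f : ℕ → ℝ} (hf : Function.Injective f)
    (h : ∀ t, t ∈ Set.range f ↔ t ∈ X ∧ 0 < t) : ℕ ≃ {t : ℝ // t ∈ X ∧ 0 < t} :=
  (Equiv.ofInjective f hf).trans (Equiv.subtypeEquivRight h)

lemma multipliable_posPart_iff {X : Set ℝ} {f : ℕ → ℝ} (hf : Function.Injective f)
    (h : ∀ t, t ∈ Set.range f ↔ t ∈ X ∧ 0 < t) (F : ℝ → ℂ) :
    (Multipliable fun a : {t : ℝ // t ∈ X ∧ 0 < t} => F a) ↔ Multipliable fun n => F (f n) :=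
  ((equivPosPart hf h).multipliable_iff
    (f := fun a : {t : ℝ // t ∈ X ∧ 0 < t} => F a)).symm

lemma tprod_posPart {X : Set ℝ} {f : ℕ → ℝ} (hf : Function.Injective f)
    (h : ∀ t, t ∈ Set.range f ↔ t ∈ X ∧ 0 < t) (F : ℝ → ℂ) :
    ∏' a : {t : ℝ // t ∈ X ∧ 0 < t}, F a = ∏' n, F (f n) :=
  ((equivPosPart hf h).tprod_eq fun a => F a).symm

lemma injective_succ_of_step {e : ℕ → ℝ} {r : ℝ} (hr0 : 0 < r)
    (hr : ∀ n, r ≤ e (n + 1) - e n) : Function.Injective fun n => e (n + 1) := fun i j h => by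
  simpa using (strictMono_of_step hr0 hr).injective h

/-- A symmetric separated set in which every nonnegative element has a successor within bounded
distance is enumerated by a sequence with gaps bounded from both sides. -/
lemma exists_enumeration {A : Set ℝ} (h0 : 0 ∈ A) (hneg : ∀ t ∈ A, -t ∈ A) {r R : ℝ}
    (hr0 : 0 < r) (hsep : ∀ x ∈ A, ∀ y ∈ A, x ≠ y → r ≤ |x - y|)
    (hnext : ∀ t ∈ A, ∃ u ∈ A, t < u ∧ u ≤ t + R) :
    ∃ e : ℕ → ℝ, (∀ t, t ∈ A ↔ ∃ n, |t| = e n) ∧ e 0 = 0 ∧ (∀ n, r ≤ e (n + 1) - e n) ∧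
      ∀ n, e (n + 1) - e n ≤ R := by
  have hleast : ∀ t : {t : ℝ // t ∈ A}, ∃ u : {u : ℝ // u ∈ A}, (t : ℝ) < u ∧
      ∀ w ∈ A, (t : ℝ) < w → (u : ℝ) ≤ w := by
    rintro ⟨t, ht⟩
    set S := {u ∈ A | t < u} with hS
    have hne : S.Nonempty := by
      obtain ⟨u, hu, htu, -⟩ := hnext t ht
      exact ⟨u, hu, htu⟩
    have hbd : BddBelow S := ⟨t, fun u hu => hu.2.le⟩
    obtain ⟨u, hu, hlt⟩ := Real.lt_sInf_add_pos hne hr0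
    refine ⟨⟨u, hu.1⟩, hu.2, fun w hw htw => ?_⟩
    by_contra! hwu
    have h1 := hsep u hu.1 w hw hwu.ne'
    have h2 := csInf_le hbd (show w ∈ S from ⟨hw, htw⟩)
    rw [abs_of_pos (sub_pos.mpr hwu)] at h1
    linarith
  choose next hlt hle using hleast
  set e : ℕ → {t : ℝ // t ∈ A} := fun n => next^[n] ⟨0, h0⟩ with he
  have hsucc : ∀ n, e (n + 1) = next (e n) := fun n => Function.iterate_succ_apply' next n _
  have hr : ∀ n, r ≤ (e (n + 1) : ℝ) - e n := by
    intro n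
    have h1 : (e n : ℝ) < e (n + 1) := by rw [hsucc]; exact hlt _
    have h2 := hsep _ (e (n + 1)).2 _ (e n).2 h1.ne'
    rwa [abs_of_pos (sub_pos.mpr h1)] at h2
  have he0 : (e 0 : ℝ) = 0 := rfl
  refine ⟨fun n => e n, fun t => ⟨fun ht => ?_, ?_⟩, he0, hr, fun n => ?_⟩
  · have habs : |t| ∈ A := by
      rcases abs_choice t with h | h <;> rw [h]
      · exact ht
      · exact hneg t ht
    obtain ⟨n, hn⟩ := exists_mem_Ico_of_step (e := fun n => (e n : ℝ)) hr0 hr he0 (abs_nonneg t)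
    refine ⟨n, le_antisymm ?_ hn.1⟩
    by_contra! hlt'
    have h1 := hle (e n) _ habs hlt'
    rw [← hsucc] at h1
    exact absurd hn.2 (not_lt.mpr h1)
  · rintro ⟨n, hn⟩
    have habs : |t| ∈ A := by rw [hn]; exact (e n).2
    rcases abs_choice t with h | h <;> rw [h] at habs
    · exact habs
    · simpa using hneg _ habs
  · obtain ⟨u, hu, htu, huR⟩ := hnext _ (e n).2
    have := hle (e n) u hu htu
    rw [← hsucc] at this
    linarith

section Enumerated

variable {A : Set ℝ} {e : ℕ → ℝ} {r : ℝ} (hA : ∀ t, t ∈ A ↔ ∃ n, |t| = e n) (he0 : e 0 = 0)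
  (hr0 : 0 < r) (hr : ∀ n, r ≤ e (n + 1) - e n)
include hA he0 hr0 hr

lemma mem_range_succ_iff (t : ℝ) : t ∈ Set.range (fun n => e (n + 1)) ↔ t ∈ A ∧ 0 < t := by
  have he := strictMono_of_step hr0 hr
  constructor
  · rintro ⟨n, rfl⟩
    have := pos_of_strictMono he he0 n
    exact ⟨(hA _).mpr ⟨n + 1, abs_of_pos this⟩, this⟩
  · rintro ⟨ht, ht0⟩
    obtain ⟨n, hn⟩ := (hA t).mp ht
    rw [abs_of_pos ht0] at hn
    rcases n with _ | n
    · linarith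
    · exact ⟨n, hn.symm⟩

lemma multipliable_sQC (z : ℂ) :
    Multipliable fun a : {t : ℝ // t ∈ A ∧ 0 < t} => (1 - z ^ 2 / ((a : ℝ) : ℂ) ^ 2) := by
  have hs := summable_one_div_sq_of_step hr0 hr he0
  have h := multipliable_one_sub_mul_sq hs (isTruncation_full (e := e) 0).nonneg z
  rw [multipliable_posPart_iff (injective_succ_of_step hr0 hr)
    (mem_range_succ_iff hA he0 hr0 hr) fun a => 1 - z ^ 2 / (a : ℂ) ^ 2]
  refine h.congr fun n => ?_
  push_cast
  ring

lemma sQC_eq_oddProd : sQC A = oddProd fun n => 1 / e (n + 1) ^ 2 := by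
  ext z
  rw [sQC, oddProd, tprod_posPart (injective_succ_of_step hr0 hr)
    (mem_range_succ_iff hA he0 hr0 hr) fun a => 1 - z ^ 2 / (a : ℂ) ^ 2]
  congr 1
  refine tprod_congr fun n => ?_
  push_cast
  ring

lemma neg_mem_bQC_iff (t : ℝ) : -t ∈ bQC A ↔ t ∈ bQC A := by
  simp only [bQC, cQC, Set.mem_ofPred_eq, sQC_eq_oddProd hA he0 hr0 hr, Complex.ofReal_neg,
    deriv_oddProd_neg]

lemma zero_notMem_bQC : (0 : ℝ) ∉ bQC A := by
  have hs := summable_one_div_sq_of_step hr0 hr he0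
  simp only [bQC, cQC, Set.mem_ofPred_eq, sQC_eq_oddProd hA he0 hr0 hr, Complex.ofReal_zero,
    deriv_oddProd_zero hs (isTruncation_full (e := e) 0).nonneg]
  exact one_ne_zero

lemma notMem_bQC_of_mem {t : ℝ} (ht : t ∈ A) : t ∉ bQC A := by
  have he := strictMono_of_step hr0 hr
  have hs := summable_one_div_sq_of_step hr0 hr he0
  obtain ⟨n, hn⟩ := (hA t).mp ht
  have h : |t| ∉ bQC A := by
    rw [hn]
    simp only [bQC, cQC, Set.mem_ofPred_eq, sQC_eq_oddProd hA he0 hr0 hr]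
    exact deriv_oddProd_ne_zero_of_seq he he0 hs n
  rcases abs_choice t with h' | h'
  · rwa [h'] at h
  · rwa [h', neg_mem_bQC_iff hA he0 hr0 hr] at h

lemma mem_bQC_iff_of_mem_gap {m : ℕ} {t : ℝ} (ht : t ∈ Set.Ioo (e m) (e (m + 1))) :
    t ∈ bQC A ↔ oddProdLogDeriv (fun n => 1 / e (n + 1) ^ 2) (t ^ 2) = 0 := by
  have he := strictMono_of_step hr0 hr
  have hs := summable_one_div_sq_of_step hr0 hr he0
  simp only [bQC, cQC, Set.mem_ofPred_eq, sQC_eq_oddProd hA he0 hr0 hr]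
  exact (isTruncation_full (e := e) m).deriv_eq_zero_iff he he0 hs le_rfl ht

lemma eq_of_mem_bQC_of_mem_gap {m : ℕ} {t u : ℝ} (ht : t ∈ Set.Ioo (e m) (e (m + 1)))
    (hu : u ∈ Set.Ioo (e m) (e (m + 1))) (htb : t ∈ bQC A) (hub : u ∈ bQC A) : t = u := by
  have he := strictMono_of_step hr0 hr
  have hs := summable_one_div_sq_of_step hr0 hr he0
  rw [mem_bQC_iff_of_mem_gap hA he0 hr0 hr ht] at htb
  rw [mem_bQC_iff_of_mem_gap hA he0 hr0 hr hu] at hub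
  rcases lt_trichotomy t u with h | h | h
  · have := (isTruncation_full (e := e) m).oddProdLogDeriv_lt he he0 hs le_rfl ht hu h
    linarith
  · exact h
  · have := (isTruncation_full (e := e) m).oddProdLogDeriv_lt he he0 hs le_rfl hu ht h
    linarith

lemma exists_seq_bQC : ∃ β : ℕ → ℝ, (∀ n, β n ∈ Set.Ioo (e n) (e (n + 1))) ∧
    ∀ t, t ∈ Set.range β ↔ t ∈ bQC A ∧ 0 < t := by
  have he := strictMono_of_step hr0 hr
  have hs := summable_one_div_sq_of_step hr0 hr he0
  obtain ⟨β, hβ, hβ0⟩ := exists_zero_seq he he0 hs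
  refine ⟨β, hβ, fun t => ⟨?_, ?_⟩⟩
  · rintro ⟨n, rfl⟩
    exact ⟨(mem_bQC_iff_of_mem_gap hA he0 hr0 hr (hβ n)).mpr (hβ0 n),
      pos_of_mem_gap he he0 (hβ n)⟩
  · rintro ⟨ht, ht0⟩
    obtain ⟨n, hn⟩ := exists_mem_Ico_of_step hr0 hr he0 ht0.le
    refine ⟨n, ?_⟩
    have hne : e n ≠ t := by
      rintro rfl
      exact notMem_bQC_of_mem hA he0 hr0 hr ((hA _).mpr ⟨n, abs_of_pos ht0⟩) ht
    exact eq_of_mem_bQC_of_mem_gap hA he0 hr0 hr (hβ n) ⟨lt_of_le_of_ne hn.1 hne, hn.2⟩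
      ((mem_bQC_iff_of_mem_gap hA he0 hr0 hr (hβ n)).mpr (hβ0 n)) ht

lemma cQC_eq_tprod (z : ℂ) :
    cQC A z = ∏' b : {t : ℝ // t ∈ bQC A ∧ 0 < t}, (1 - z ^ 2 / ((b : ℝ) : ℂ) ^ 2) := by
  have he := strictMono_of_step hr0 hr
  have hs := summable_one_div_sq_of_step hr0 hr he0
  obtain ⟨β, hβ, hrange⟩ := exists_seq_bQC hA he0 hr0 hr
  have hmono : StrictMono β :=
    strictMono_nat_of_lt_succ fun n => (hβ n).2.trans (hβ (n + 1)).1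
  rw [tprod_posPart hmono.injective hrange fun a => 1 - z ^ 2 / (a : ℂ) ^ 2, cQC,
    sQC_eq_oddProd hA he0 hr0 hr]
  exact deriv_oddProd_eq_tprod he he0 hs hβ (fun n =>
    (mem_bQC_iff_of_mem_gap hA he0 hr0 hr (hβ n)).mp ((hrange _).mp ⟨n, rfl⟩).1) z

lemma existsUnique_bQC_of_consecutive {p q : ℝ} (hp : p = 0 ∨ p ∈ A ∧ 0 < p) (hq : q ∈ A)
    (hpq : p < q) (hno : ∀ s ∈ A, ¬(p < s ∧ s < q)) :
    ∃! b : ℝ, b ∈ bQC A ∧ p < b ∧ b < q := by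
  have he := strictMono_of_step hr0 hr
  obtain ⟨m, rfl⟩ : ∃ m, p = e m := by
    rcases hp with rfl | hp
    · exact ⟨0, he0.symm⟩
    · obtain ⟨m, hm⟩ := (hA p).mp hp.1
      exact ⟨m, by rwa [abs_of_pos hp.2] at hm⟩
  have hq0 : 0 < q := (nonneg_of_strictMono he he0 m).trans_lt hpq
  obtain ⟨n, hn⟩ := (hA q).mp hq
  rw [abs_of_pos hq0] at hn
  subst hn
  have hmn : m < n := he.lt_iff_lt.mp hpq
  have hn : n = m + 1 := by
    by_contra hne
    refine hno (e (m + 1)) ((mem_range_succ_iff hA he0 hr0 hr _).mp ⟨m, rfl⟩).1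
      ⟨he m.lt_succ_self, he (by omega)⟩
  subst hn
  obtain ⟨β, hβ, hrange⟩ := exists_seq_bQC hA he0 hr0 hr
  refine ⟨β m, ⟨((hrange _).mp ⟨m, rfl⟩).1, (hβ m).1, (hβ m).2⟩, fun b hb => ?_⟩
  exact eq_of_mem_bQC_of_mem_gap hA he0 hr0 hr hb.2 (hβ m) hb.1 ((hrange _).mp ⟨m, rfl⟩).1

lemma uniformlyDiscrete_bQC : UniformlyDiscreteR (bQC A) := by
  obtain ⟨β, hβ, hrange⟩ := exists_seq_bQC hA he0 hr0 hr
  have hβb : ∀ n, β n ∈ bQC A ∧ 0 < β n := fun n => (hrange _).mp ⟨n, rfl⟩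
  have hβ0 := fun n => (mem_bQC_iff_of_mem_gap hA he0 hr0 hr (hβ n)).mp (hβb n).1
  set δ := r / (3 * (1 + 4 * ∑' k : ℤ, 1 / (k : ℝ) ^ 2)) with hδ
  have hZ0 : 0 ≤ ∑' k : ℤ, 1 / (k : ℝ) ^ 2 := tsum_nonneg fun k => by positivity
  have hδ0 : 0 < δ := by positivity
  have hstep : ∀ n, δ ≤ β (n + 1) - β n := fun n =>
    sub_ge_of_consecutive_zeros hr0 hr he0 (hβ n) (hβ (n + 1)) (hβ0 n) (hβ0 (n + 1))
  have hmono := strictMono_of_step hδ0 hstep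
  have habs : ∀ t ∈ bQC A, ∃ n, |t| = β n := by
    intro t ht
    have ht0 : t ≠ 0 := by
      rintro rfl
      exact zero_notMem_bQC hA he0 hr0 hr ht
    obtain ⟨n, hn⟩ := (hrange |t|).mpr ⟨by
      rcases abs_choice t with h | h <;> rw [h]
      · exact ht
      · exact (neg_mem_bQC_iff hA he0 hr0 hr t).mpr ht, abs_pos.mpr ht0⟩
    exact ⟨n, hn.symm⟩
  refine ⟨min δ (β 0), lt_min hδ0 (hβb 0).2, fun t ht u hu htu => ?_⟩
  obtain ⟨m, hm⟩ := habs t ht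
  obtain ⟨n, hn⟩ := habs u hu
  by_cases hmn : m = n
  · subst hmn
    refine (min_le_right _ _).trans ?_
    have h0 : β 0 ≤ β m := hmono.monotone m.zero_le
    have h1 : t = -u := by
      rcases abs_eq_abs.mp (hm.trans hn.symm) with h | h
      · exact absurd h htu
      · exact h
    rw [h1, show -u - u = (-2) * u by ring, abs_mul, hn, abs_neg, abs_two]
    have := (hβb 0).2
    linarith
  · refine (min_le_left _ _).trans ?_
    have h1 : 1 ≤ |(m : ℝ) - n| := by
      have : (1 : ℤ) ≤ |(m : ℤ) - n| := Int.one_le_abs (sub_ne_zero.mpr (by exact_mod_cast hmn))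
      exact_mod_cast this
    calc δ ≤ δ * |(m : ℝ) - n| := le_mul_of_one_le_right hδ0.le h1
      _ ≤ |β m - β n| := mul_abs_le_abs_sub_of_step hstep n m
      _ = |(|t| - |u|)| := by rw [hm, hn]
      _ ≤ |t - u| := abs_abs_sub_abs_le_abs_sub t u

lemma relativelyDense_bQC {R : ℝ} (hR : ∀ n, e (n + 1) - e n ≤ R) :
    RelativelyDenseR (bQC A) := by
  obtain ⟨β, hβ, hrange⟩ := exists_seq_bQC hA he0 hr0 hr
  have hR0 : 0 < R := hr0.trans_le ((hr 0).trans (hR 0))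
  have hpos : ∀ v : ℝ, 0 ≤ v → ∃ b ∈ bQC A, |v - b| < R := by
    intro v hv
    obtain ⟨n, hn⟩ := exists_mem_Ico_of_step hr0 hr he0 hv
    refine ⟨β n, ((hrange _).mp ⟨n, rfl⟩).1, ?_⟩
    rw [abs_lt]
    constructor <;> linarith [hn.1, hn.2, (hβ n).1, (hβ n).2, hR n]
  refine ⟨R, hR0, fun v => ?_⟩
  rcases le_total 0 v with hv | hv
  · exact hpos v hv
  · obtain ⟨b, hb, h⟩ := hpos (-v) (by linarith)
    refine ⟨-b, (neg_mem_bQC_iff hA he0 hr0 hr b).mpr hb, ?_⟩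
    rwa [← abs_neg, show -(v - -b) = -v - b by ring]

end Enumerated

end Assembly

end Analysis

section QuadraticField

lemma one_le_abs_norm_of_ne_zero {K : Type*} [Field K] [NumberField K] {a : 𝓞 K} (ha : a ≠ 0) :
    (1 : ℚ) ≤ |Algebra.norm ℚ (a : K)| := by
  rw [← Algebra.coe_norm_int]
  exact_mod_cast Int.one_le_abs (Algebra.norm_ne_zero_iff.mpr ha)

variable {K : Type*} [Field K] [NumberField K] (hdeg : Module.finrank ℚ K = 2)
  {g : K ≃+* K} (hg : g ≠ RingEquiv.refl K)
include hdeg hg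

lemma norm_eq_mul_conj (α : K) : algebraMap ℚ K (Algebra.norm ℚ α) = α * g α := by
  have : Algebra.IsQuadraticExtension ℚ K := { finrank_eq_two' := hdeg }
  classical
  set g' : K ≃ₐ[ℚ] K := AlgEquiv.ofRingEquiv (f := g) fun r => by simp with hg'
  have hne : (1 : K ≃ₐ[ℚ] K) ≠ g' := fun h => hg (by
    ext a
    exact (DFunLike.congr_fun h a).symm)
  have hcard : Fintype.card (K ≃ₐ[ℚ] K) = 2 := by
    rw [← Nat.card_eq_fintype_card, IsGalois.card_aut_eq_finrank, hdeg]
  have huniv : ({1, g'} : Finset (K ≃ₐ[ℚ] K)) = Finset.univ := by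
    rw [← Finset.card_eq_iff_eq_univ, hcard, Finset.card_pair hne]
  rw [Algebra.norm_eq_prod_automorphisms, ← huniv, Finset.prod_pair hne]
  rfl

lemma conj_conj (α : K) : g (g α) = α := by
  have h : α * g α = g α * g (g α) := by
    rw [← map_mul, ← norm_eq_mul_conj hdeg hg, eq_ratCast, map_ratCast]
  rcases eq_or_ne (g α) 0 with h0 | h0
  · rw [h0, map_zero, (map_eq_zero g).mp h0]
  · rw [mul_comm] at h
    exact (mul_left_cancel₀ h0 h).symm

lemma embedding_mul_conj (ι : K →+* ℝ) (α : K) :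
    ι α * ι (g α) = (Algebra.norm ℚ α : ℚ) := by
  rw [← map_mul, ← norm_eq_mul_conj hdeg hg, eq_ratCast, map_ratCast]

/-- Nonzero elements of a fractional ideal have absolute norm bounded below. -/
lemma exists_le_abs_mul_abs_conj (ι : K →+* ℝ) (𝔄 : FractionalIdeal (𝓞 K)⁰ K) :
    ∃ c > 0, ∀ α ∈ 𝔄, α ≠ 0 → c ≤ |ι α| * |ι (g α)| := by
  obtain ⟨d, hd, hfrac⟩ := 𝔄.2
  have hd0 : d ≠ 0 := nonZeroDivisors.ne_zero hd
  have hdK : (d : K) ≠ 0 := by simpa using hd0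
  have hNd : (0 : ℝ) < |((Algebra.norm ℚ (d : K) : ℚ) : ℝ)| := by
    rw [abs_pos]
    exact_mod_cast (Algebra.norm_ne_zero_iff.mpr hdK)
  refine ⟨1 / |((Algebra.norm ℚ (d : K) : ℚ) : ℝ)|, by positivity, fun α hα hα0 => ?_⟩
  obtain ⟨b, hb⟩ := hfrac α hα
  have hb' : (b : K) = d * α := by rw [← Algebra.smul_def]; exact hb
  have hb0 : b ≠ 0 := by
    rintro rfl
    exact mul_ne_zero hdK hα0 (hb'.symm.trans (map_zero (algebraMap (𝓞 K) K)))
  have h1 := one_le_abs_norm_of_ne_zero hb0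
  rw [hb', map_mul, abs_mul] at h1
  rw [← abs_mul, embedding_mul_conj hdeg hg, div_le_iff₀ hNd, mul_comm]
  exact_mod_cast h1

lemma abs_embedding_mul_conj_unit (ι : K →+* ℝ) (v : (𝓞 K)ˣ) :
    |ι ((v : 𝓞 K) : K)| * |ι (g ((v : 𝓞 K) : K))| = 1 := by
  have h := NumberField.isUnit_iff_norm.mp v.isUnit
  rw [← abs_mul, embedding_mul_conj hdeg hg]
  rw [RingOfIntegers.coe_norm] at h
  exact_mod_cast h

lemma exists_ringOfIntegers_conj_eq_neg : ∃ δ : 𝓞 K, δ ≠ 0 ∧ g (δ : K) = -δ := by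
  obtain ⟨w, hw⟩ : ∃ w : 𝓞 K, g (w : K) ≠ w := by
    by_contra! h
    refine hg (RingEquiv.ext fun a => ?_)
    obtain ⟨x, y, hy, rfl⟩ := IsFractionRing.div_surjective (A := 𝓞 K) a
    rw [map_div₀]
    exact congrArg₂ _ (h x) (h y)
  have hwg : IsIntegral ℤ ((w : K) - g w) :=
    w.isIntegral_coe.sub (w.isIntegral_coe.map g.toRingHom.toIntAlgHom)
  refine ⟨⟨(w : K) - g w, hwg⟩, fun h => hw ?_, ?_⟩
  · exact (sub_eq_zero.mp (congrArg (algebraMap (𝓞 K) K) h)).symm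
  · change g ((w : K) - g w) = -((w : K) - g w)
    rw [map_sub, conj_conj hdeg hg, neg_sub]

/-- Multiplying by even powers of a unit and by a sign makes the first embedding positive and
the second one small without changing the sign of the norm. -/
lemma exists_mem_pos_conj_small (ι : K →+* ℝ) {v : (𝓞 K)ˣ} (hv : 1 < ι ((v : 𝓞 K) : K))
    {𝔄 : FractionalIdeal (𝓞 K)⁰ K} {w : K} (hw : w ∈ 𝔄) (hw0 : w ≠ 0) {ε : ℝ} (hε : 0 < ε) :
    ∃ u ∈ 𝔄, 0 < ι u ∧ |ι (g u)| < ε ∧ 0 < ι (g u) * (ι w * ι (g w)) := by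
  have hvg : |ι (g ((v : 𝓞 K) : K))| < 1 := by
    have h := abs_embedding_mul_conj_unit hdeg hg ι v
    rw [abs_of_pos (by linarith)] at h
    nlinarith [abs_nonneg (ι (g ((v : 𝓞 K) : K)))]
  have hιw : ι w ≠ 0 := (map_ne_zero ι).mpr hw0
  have hgw : ι (g w) ≠ 0 := (map_ne_zero ι).mpr ((map_ne_zero g).mpr hw0)
  have hgv : ι (g ((v : 𝓞 K) : K)) ≠ 0 := by
    simp
  have hlim : Filter.Tendsto (fun k : ℕ => |ι (g w)| * |ι (g ((v : 𝓞 K) : K))| ^ (2 * k))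
      Filter.atTop (nhds 0) := by
    have h := ((tendsto_pow_atTop_nhds_zero_of_lt_one (abs_nonneg _) hvg).comp
      (Filter.tendsto_id.const_mul_atTop' (zero_lt_two' ℕ))).const_mul |ι (g w)|
    rwa [mul_zero] at h
  obtain ⟨k, hk⟩ := (hlim.eventually_lt_const hε).exists
  have hmem : w * ((v : 𝓞 K) : K) ^ (2 * k) ∈ 𝔄 := by
    have h := Submodule.smul_mem (𝔄 : Submodule (𝓞 K) K) ((v : 𝓞 K) ^ (2 * k)) hw
    rw [Algebra.smul_def, map_pow, mul_comm] at h
    exact h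
  have hpos : 0 < ι ((v : 𝓞 K) : K) ^ (2 * k) := by positivity
  have hpos' : 0 < ι (g ((v : 𝓞 K) : K)) ^ (2 * k) := by
    rw [pow_mul]
    positivity
  have hk' : |ι (g w) * ι (g ((v : 𝓞 K) : K)) ^ (2 * k)| < ε := by rwa [abs_mul, abs_pow]
  rcases hιw.lt_or_gt with h | h
  · refine ⟨-(w * ((v : 𝓞 K) : K) ^ (2 * k)), neg_mem (S := Submodule (𝓞 K) K) hmem, ?_, ?_, ?_⟩
    · rw [map_neg, map_mul, map_pow]
      nlinarith
    · simpa only [map_neg, map_mul, map_pow, abs_neg] using hk'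
    · simp only [map_neg, map_mul, map_pow]
      have : 0 < ι (g w) ^ 2 * (-ι w) * ι (g ((v : 𝓞 K) : K)) ^ (2 * k) := by
        have : 0 < -ι w := by linarith
        positivity
      linarith
  · refine ⟨w * ((v : 𝓞 K) : K) ^ (2 * k), hmem, ?_, ?_, ?_⟩
    · rw [map_mul, map_pow]
      positivity
    · simpa only [map_mul, map_pow] using hk'
    · simp only [map_mul, map_pow]
      have : 0 < ι (g w) ^ 2 * ι w * ι (g ((v : 𝓞 K) : K)) ^ (2 * k) := by positivity
      linarith

lemma exists_mem_pos_conj_pos_and_neg (ι : K →+* ℝ) {v : (𝓞 K)ˣ}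
    (hv : 1 < ι ((v : 𝓞 K) : K)) {𝔄 : FractionalIdeal (𝓞 K)⁰ K} (h𝔄 : 𝔄 ≠ 0) {ε : ℝ}
    (hε : 0 < ε) :
    (∃ u ∈ 𝔄, 0 < ι u ∧ 0 < ι (g u) ∧ ι (g u) < ε) ∧
      ∃ u ∈ 𝔄, 0 < ι u ∧ ι (g u) < 0 ∧ -ε < ι (g u) := by
  obtain ⟨w, hw, hw0⟩ : ∃ w ∈ 𝔄, w ≠ 0 := by
    by_contra! h
    exact h𝔄 (FractionalIdeal.eq_zero_iff.mpr h)
  obtain ⟨δ, hδ0, hδ⟩ := exists_ringOfIntegers_conj_eq_neg hdeg hg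
  have hδK : (δ : K) ≠ 0 := by simpa using hδ0
  have hwδ : w * δ ∈ 𝔄 := by
    have h := Submodule.smul_mem (𝔄 : Submodule (𝓞 K) K) δ hw
    rwa [Algebra.smul_def, mul_comm] at h
  obtain ⟨u₁, hu₁, hpos₁, hlt₁, hs₁⟩ := exists_mem_pos_conj_small hdeg hg ι hv hw hw0 hε
  obtain ⟨u₂, hu₂, hpos₂, hlt₂, hs₂⟩ :=
    exists_mem_pos_conj_small hdeg hg ι hv hwδ (mul_ne_zero hw0 hδK) hε
  rw [abs_lt] at hlt₁ hlt₂
  have hιδ : 0 < ι δ ^ 2 := by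
    have := (map_ne_zero ι).mpr hδK
    positivity
  have hs₂' : ι (g u₂) * (ι w * ι (g w)) < 0 := by
    rw [map_mul, map_mul, map_mul, hδ, map_neg] at hs₂
    nlinarith
  rcases lt_or_ge 0 (ι w * ι (g w)) with h | h
  · exact ⟨⟨u₁, hu₁, hpos₁, pos_of_mul_pos_left hs₁ h.le, hlt₁.2⟩,
      u₂, hu₂, hpos₂, neg_of_mul_neg_left hs₂' h.le, hlt₂.1⟩
  · exact ⟨⟨u₂, hu₂, hpos₂, pos_of_mul_neg_left hs₂' h, hlt₂.2⟩,
      u₁, hu₁, hpos₁, neg_of_mul_pos_left hs₁ h, hlt₁.1⟩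

end QuadraticField

section ModelIdeal

variable {K : Type*} [Field K] [NumberField K] {ι : K →+* ℝ} {g : K ≃+* K} {θ : ℝ}
  {𝔄 : FractionalIdeal (𝓞 K)⁰ K} {x : ℝ}

lemma zero_mem_aQCF (hθ : 0 < θ) : (0 : ℝ) ∈ aQCF K ι g θ 𝔄 x :=
  ⟨0, zero_mem (𝔄 : Submodule (𝓞 K) K), map_zero ι, by simpa using Real.rpow_pos_of_pos hθ _⟩

lemma neg_mem_aQCF {t : ℝ} (ht : t ∈ aQCF K ι g θ 𝔄 x) : -t ∈ aQCF K ι g θ 𝔄 x := by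
  obtain ⟨α, hα, rfl, h⟩ := ht
  exact ⟨-α, neg_mem (S := Submodule (𝓞 K) K) hα, map_neg ι α, by simpa using h⟩

lemma uniformlyDiscrete_aQCF (hdeg : Module.finrank ℚ K = 2) (hg : g ≠ RingEquiv.refl K)
    (hθ : 0 < θ) : UniformlyDiscreteR (aQCF K ι g θ 𝔄 x) := by
  obtain ⟨c, hc, h⟩ := exists_le_abs_mul_abs_conj hdeg hg ι 𝔄
  have hθx : 0 < θ ^ (-x) := Real.rpow_pos_of_pos hθ _
  refine ⟨c / (2 * θ ^ (-x)), by positivity, ?_⟩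
  rintro _ ⟨α, hα, rfl, hα'⟩ _ ⟨β, hβ, rfl, hβ'⟩ hne
  have hsub := h (α - β) (sub_mem (S := Submodule (𝓞 K) K) hα hβ)
    (sub_ne_zero.mpr fun h => hne (by rw [h]))
  rw [map_sub, map_sub, map_sub] at hsub
  have h2 : |ι (g α) - ι (g β)| ≤ 2 * θ ^ (-x) := by
    have := abs_sub (ι (g α)) (ι (g β))
    linarith
  rw [div_le_iff₀ (by positivity)]
  exact hsub.trans (by gcongr)

lemma exists_bounded_step_aQCF (hdeg : Module.finrank ℚ K = 2) (hg : g ≠ RingEquiv.refl K)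
    (h𝔄 : 𝔄 ≠ 0) {v : (𝓞 K)ˣ} (hv : 1 < ι ((v : 𝓞 K) : K)) (hθ : 0 < θ) :
    ∃ R, ∀ t ∈ aQCF K ι g θ 𝔄 x, ∃ u ∈ aQCF K ι g θ 𝔄 x, t < u ∧ u ≤ t + R := by
  obtain ⟨⟨a, ha, ha0, hga, hga'⟩, b, hb, hb0, hgb, hgb'⟩ :=
    exists_mem_pos_conj_pos_and_neg hdeg hg ι hv h𝔄 (Real.rpow_pos_of_pos hθ (-x))
  refine ⟨max (ι a) (ι b), ?_⟩
  rintro _ ⟨α, hα, rfl, hα'⟩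
  rw [abs_lt] at hα'
  rcases le_or_gt (ι (g α)) 0 with h | h
  · refine ⟨ι (α + a), ⟨α + a, add_mem (S := Submodule (𝓞 K) K) hα ha, rfl, ?_⟩, ?_, ?_⟩
    · rw [map_add, map_add, abs_lt]
      constructor <;> linarith
    · rw [map_add]
      linarith
    · rw [map_add]
      gcongr
      exact le_max_left _ _
  · refine ⟨ι (α + b), ⟨α + b, add_mem (S := Submodule (𝓞 K) K) hα hb, rfl, ?_⟩, ?_, ?_⟩
    · rw [map_add, map_add, abs_lt]
      constructor <;> linarith
    · rw [map_add]
      linarith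
    · rw [map_add]
      gcongr
      exact le_max_right _ _

end ModelIdeal

/-- For a rank-1 model ideal `𝔞`: the zero set `𝔟` of `c_𝔞 = s_𝔞′` is Delaunay, its zeros
interlace those of `s_𝔞`, and `c_𝔞(z) = ∏_{β∈𝔟, β>0}(1 - z²/β²)`. -/
theorem stmt18 (K : Type*) [Field K] [NumberField K]
    (hdeg : Module.finrank ℚ K = 2) (ι : K →+* ℝ)
    (g : K ≃+* K) (hg : g ≠ RingEquiv.refl K)
    (θu : (𝓞 K)ˣ) (hθ : 1 < ι ((θu : 𝓞 K) : K))
    (hfund : ∀ v : (𝓞 K)ˣ, ∃ n : ℤ, ((v : 𝓞 K) : K) = (((θu ^ n : (𝓞 K)ˣ) : 𝓞 K) : K)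
      ∨ ((v : 𝓞 K) : K) = -(((θu ^ n : (𝓞 K)ˣ) : 𝓞 K) : K))
    (𝔄 : FractionalIdeal (𝓞 K)⁰ K) (h𝔄 : 𝔄 ≠ 0) (x : ℝ) :
    -- the product defining `s_𝔞` converges and `s_𝔞` is entire
    (∀ z : ℂ, Multipliable fun a : {t : ℝ // t ∈ aQCF K ι g (ι ((θu : 𝓞 K) : K)) 𝔄 x ∧ 0 < t}
        => (1 - z ^ 2 / ((a : ℝ) : ℂ) ^ 2)) ∧
    Differentiable ℂ (sQC (aQCF K ι g (ι ((θu : 𝓞 K) : K)) 𝔄 x)) ∧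
    -- (i) `𝔟` is a Delaunay set
    IsDelaunayR (bQC (aQCF K ι g (ι ((θu : 𝓞 K) : K)) 𝔄 x)) ∧
    -- (ii) interlacing: the positive zeros of `c_𝔞` avoid `𝔞` and there is exactly one of
    -- them strictly between consecutive elements of `{0} ∪ 𝔞⁺`
    (∀ b ∈ bQC (aQCF K ι g (ι ((θu : 𝓞 K) : K)) 𝔄 x), 0 < b →
        b ∉ aQCF K ι g (ι ((θu : 𝓞 K) : K)) 𝔄 x) ∧
    (∀ p q : ℝ,
      (p = 0 ∨ (p ∈ aQCF K ι g (ι ((θu : 𝓞 K) : K)) 𝔄 x ∧ 0 < p)) →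
      q ∈ aQCF K ι g (ι ((θu : 𝓞 K) : K)) 𝔄 x → p < q →
      (∀ r ∈ aQCF K ι g (ι ((θu : 𝓞 K) : K)) 𝔄 x, ¬(p < r ∧ r < q)) →
      ∃! b : ℝ, b ∈ bQC (aQCF K ι g (ι ((θu : 𝓞 K) : K)) 𝔄 x) ∧ p < b ∧ b < q) ∧
    -- (iii) the product representation of `c_𝔞`
    (∀ z : ℂ, cQC (aQCF K ι g (ι ((θu : 𝓞 K) : K)) 𝔄 x) z
        = ∏' b : {t : ℝ // t ∈ bQC (aQCF K ι g (ι ((θu : 𝓞 K) : K)) 𝔄 x) ∧ 0 < t},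
            (1 - z ^ 2 / ((b : ℝ) : ℂ) ^ 2)) := by
  have hθ0 : 0 < ι ((θu : 𝓞 K) : K) := one_pos.trans hθ
  obtain ⟨r, hr0, hsep⟩ := uniformlyDiscrete_aQCF (ι := ι) (𝔄 := 𝔄) (x := x) hdeg hg hθ0
  obtain ⟨R, hnext⟩ := exists_bounded_step_aQCF (x := x) hdeg hg h𝔄 hθ hθ0
  obtain ⟨e, hA, he0, hr, hR⟩ :=
    exists_enumeration (zero_mem_aQCF hθ0) (fun t => neg_mem_aQCF) hr0 hsep hnext
  refine ⟨multipliable_sQC hA he0 hr0 hr, ?_,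
    ⟨uniformlyDiscrete_bQC hA he0 hr0 hr, relativelyDense_bQC hA he0 hr0 hr hR⟩,
    fun b hb _ hbA => notMem_bQC_of_mem hA he0 hr0 hr hbA hb,
    fun p q hp hq hpq hno => existsUnique_bQC_of_consecutive hA he0 hr0 hr hp hq hpq hno,
    cQC_eq_tprod hA he0 hr0 hr⟩
  rw [sQC_eq_oddProd hA he0 hr0 hr]
  exact differentiable_oddProd (summable_one_div_sq_of_step hr0 hr he0)
    (isTruncation_full (e := e) 0).nonneg
end
end
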